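/- Let n ≥ 2 and φ : (0,∞) × (0,∞) → (0,∞) be C¹ with ∂₁φ ≥ 0 and ∂₂φ ≥ 0, at least one strictly positive everywhere. Let K ⊂ ℝ^{n+1} be a smooth, strictly convex, origin-centred body whose support function h satisfies φ(h, |Dh|) 𝒦 = h^{n+2} on S^n. Then K is a ball centred at the origin. -/

import Mathlib

open MeasureTheory Metric
open scoped RealInnerProductSpace ENNReal

noncomputable section

abbrev E (n : ℕ) : Type := EuclideanSpace ℝ (Fin (n + 1))

/-- The Hessian of `H` as a continuous linear map. -/
def hess {n : ℕ} (H : E n → ℝ) (x : E n) : E n →L[ℝ] E n :=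
  fderiv ℝ (gradient H) x

/-- The rank-one projection `y ↦ ⟪x, y⟫ • x`. -/
def proj {n : ℕ} (x : E n) : E n →L[ℝ] E n :=
  ((innerSL ℝ) x).smulRight x

/-- `σ_n = det(∇̄²h + h ḡ)/det ḡ = 1/𝒦`, computed as the determinant of
`D²H + x ⊗ x` where `H` is the 1-homogeneous extension of the support function. -/
def sigmaDet {n : ℕ} (H : E n → ℝ) (x : E n) : ℝ :=
  LinearMap.det ((hess H x + proj x) : E n →L[ℝ] E n).toLinearMap

/-- Tangential (spherical) gradient of the restriction to the unit sphere. -/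
def tgrad {n : ℕ} (F : E n → ℝ) (x : E n) : E n :=
  gradient F x - ⟪gradient F x, x⟫ • x

/-- The convex body with support function `H`. -/
def body {n : ℕ} (H : E n → ℝ) : Set (E n) :=
  {y | ∀ x ∈ sphere (0 : E n) 1, ⟪y, x⟫ ≤ H x}

/-- The midpoint form of the one-dimensional Brunn–Minkowski inequality. -/
lemma volume_add_volume_le_two_mul_of_midpoint {A B C : Set ℝ} (hA : MeasurableSet A)
    (hB : MeasurableSet B) (hA0 : A.Nonempty) (hB0 : B.Nonempty)
    (h : ∀ a ∈ A, ∀ b ∈ B, (1 / 2 : ℝ) * (a + b) ∈ C) :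
    volume A + volume B ≤ 2 * volume C := by
  have key : ∀ K L : Set ℝ, IsCompact K → IsCompact L → K.Nonempty → L.Nonempty → K ⊆ A → L ⊆ B →
      volume K + volume L ≤ 2 * volume C := by
    intro K L hK hL hK0 hL0 hKA hLB
    obtain ⟨M, hMK, hM⟩ := hK.exists_isGreatest hK0
    obtain ⟨m, hmL, hm⟩ := hL.exists_isLeast hL0
    have h1 : volume ((fun x => x + (-m)) ⁻¹' K) = volume K := measure_preimage_add_right _ _ _
    have h2 : volume ((fun x => x + (-M)) ⁻¹' L) = volume L := measure_preimage_add_right _ _ _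
    have h3 : volume ((fun x : ℝ => (1 / 2 : ℝ) * x) ⁻¹' C) = 2 * volume C := by
      rw [Real.volume_preimage_mul_left (by norm_num)]
      norm_num
    rw [← h1, ← h2, ← h3]
    have hmeas : MeasurableSet ((fun x => x + (-M)) ⁻¹' L) :=
      (measurable_add_const _) hL.measurableSet
    rw [← measure_union_add_inter _ hmeas]
    have h4 : volume ((fun x => x + (-m)) ⁻¹' K ∩ (fun x => x + (-M)) ⁻¹' L) = 0 := by
      refine measure_mono_null (t := {M + m}) ?_ (by simp)
      rintro x ⟨hx1, hx2⟩
      have e1 := hM hx1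
      have e2 := hm hx2
      simp only [Set.mem_singleton_iff]
      linarith
    rw [h4, add_zero]
    apply measure_mono
    rintro x (hx | hx)
    · have := h _ (hKA hx) _ (hLB hmL)
      simpa using this
    · have := h _ (hKA hMK) _ (hLB hx)
      simp only [Set.mem_preimage]
      convert this using 2
      ring
  obtain ⟨a, ha⟩ := hA0
  obtain ⟨b, hb⟩ := hB0
  rw [hA.measure_eq_iSup_isCompact, hB.measure_eq_iSup_isCompact]
  simp only [iSup_and']
  refine ENNReal.biSup_add_biSup_le' (p := fun K => K ⊆ A ∧ IsCompact K)
    (q := fun K => K ⊆ B ∧ IsCompact K) ⟨∅, by simp, by simp⟩ ⟨∅, by simp, by simp⟩ ?_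
  rintro K ⟨hKA, hK⟩ L ⟨hLB, hL⟩
  refine le_trans (add_le_add (measure_mono (Set.subset_insert a K))
    (measure_mono (Set.subset_insert b L)))
    (key _ _ (hK.insert a) (hL.insert b) (Set.insert_nonempty _ _) (Set.insert_nonempty _ _) ?_ ?_)
  · exact Set.insert_subset ha hKA
  · exact Set.insert_subset hb hLB

/-- The midpoint Prékopa–Leindler inequality for a measure on a real vector space. -/
def MidpointPrekopaLeindler {F : Type*} [AddCommGroup F] [Module ℝ F] [MeasurableSpace F]
    (μ : Measure F) : Prop :=
  ∀ f g u : F → ℝ≥0∞, Measurable f → Measurable g → Measurable u →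
    (∀ x y, f x * g y ≤ u ((1 / 2 : ℝ) • (x + y)) ^ 2) →
    (∫⁻ x, f x ∂μ) * (∫⁻ x, g x ∂μ) ≤ (∫⁻ x, u x ∂μ) ^ 2

lemma lintegral_add_le_two_mul_of_midpoint {F G U : ℝ → ℝ} (hF : Measurable F) (hG : Measurable G)
    (hU : Measurable U) (hF0 : ∀ x, 0 ≤ F x) (hG0 : ∀ x, 0 ≤ G x) (hU0 : ∀ x, 0 ≤ U x)
    (hF1 : ∀ x, F x ≤ 1) (hG1 : ∀ x, G x ≤ 1)
    (hFs : ∀ s < 1, ∃ x, s < F x) (hGs : ∀ s < 1, ∃ x, s < G x)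
    (h : ∀ x y s, 0 < s → s < F x → s < G y → s < U ((1 / 2 : ℝ) * (x + y))) :
    (∫⁻ x, ENNReal.ofReal (F x)) + (∫⁻ x, ENNReal.ofReal (G x)) ≤
      2 * ∫⁻ x, ENNReal.ofReal (U x) := by
  rw [lintegral_eq_lintegral_meas_lt volume (.of_forall hF0) hF.aemeasurable,
    lintegral_eq_lintegral_meas_lt volume (.of_forall hG0) hG.aemeasurable,
    lintegral_eq_lintegral_meas_lt volume (.of_forall hU0) hU.aemeasurable]
  rw [← lintegral_const_mul' _ _ (by norm_num), ← lintegral_add_left]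
  · refine setLIntegral_mono' measurableSet_Ioi ?_
    intro s hs
    rcases lt_or_ge s 1 with h1 | h1
    · exact volume_add_volume_le_two_mul_of_midpoint (measurableSet_lt measurable_const hF)
        (measurableSet_lt measurable_const hG) (hFs s h1) (hGs s h1)
        (fun a ha b hb => h a b s hs ha hb)
    · have e1 : {a | s < F a} = ∅ := by
        ext x; simpa using (hF1 x).trans h1
      have e2 : {a | s < G a} = ∅ := by
        ext x; simpa using (hG1 x).trans h1
      simp [e1, e2]
  · exact (Antitone.measurable (fun s t hst => measure_mono (fun x hx => lt_of_le_of_lt hst hx)))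

lemma ENNReal.mul_le_sq_of_add_le {x y z : ℝ≥0∞} (h : x + y ≤ 2 * z) : x * y ≤ z ^ 2 := by
  by_cases hz : z = ⊤
  · simp [hz]
  have hx : x ≠ ⊤ := by
    rintro rfl
    simp [ENNReal.mul_eq_top, hz] at h
  have hy : y ≠ ⊤ := by
    rintro rfl
    simp [ENNReal.mul_eq_top, hz] at h
  lift x to NNReal using hx
  lift y to NNReal using hy
  lift z to NNReal using hz
  norm_cast at *
  rw [← NNReal.coe_le_coe] at *
  push_cast at *
  nlinarith [sq_nonneg ((x : ℝ) - y), x.2, y.2, z.2]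

lemma prekopaLeindler_real_of_bounded {f g u : ℝ → ℝ≥0∞} (hf : Measurable f) (hg : Measurable g)
    (hu : Measurable u) (hfb : ⨆ x, f x ≠ ⊤) (hgb : ⨆ x, g x ≠ ⊤)
    (h : ∀ x y, f x * g y ≤ u ((1 / 2 : ℝ) • (x + y)) ^ 2) :
    (∫⁻ x, f x) * (∫⁻ x, g x) ≤ (∫⁻ x, u x) ^ 2 := by
  set a := ⨆ x, f x with ha
  set b := ⨆ x, g x with hb
  have hfa : ∀ x, f x ≤ a := fun x => le_iSup f x
  have hgb' : ∀ x, g x ≤ b := fun x => le_iSup g x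
  by_cases ha0 : a = 0
  · have : ∀ x, f x = 0 := fun x => le_antisymm (ha0 ▸ hfa x) bot_le
    simp [this]
  by_cases hb0 : b = 0
  · have : ∀ x, g x = 0 := fun x => le_antisymm (hb0 ▸ hgb' x) bot_le
    simp [this]
  have haR : 0 < a.toReal := ENNReal.toReal_pos ha0 hfb
  have hbR : 0 < b.toReal := ENNReal.toReal_pos hb0 hgb
  set c : ℝ := √(a.toReal * b.toReal) with hc
  have hc0 : 0 < c := Real.sqrt_pos.2 (mul_pos haR hbR)
  have hc2 : c ^ 2 = a.toReal * b.toReal := Real.sq_sqrt (mul_pos haR hbR).le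
  have hfR : ∀ x, (f x).toReal ≤ a.toReal := fun x => ENNReal.toReal_mono hfb (hfa x)
  have hgR : ∀ x, (g x).toReal ≤ b.toReal := fun x => ENNReal.toReal_mono hgb (hgb' x)
  have main := lintegral_add_le_two_mul_of_midpoint (F := fun x => (f x).toReal / a.toReal)
    (G := fun x => (g x).toReal / b.toReal)
    (U := fun x => (min (u x) (ENNReal.ofReal c)).toReal / c)
    (hf.ennreal_toReal.div_const _) (hg.ennreal_toReal.div_const _)
    ((hu.min measurable_const).ennreal_toReal.div_const _)
    (fun x => by positivity) (fun x => by positivity) (fun x => by positivity)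
    (fun x => (div_le_one haR).2 (hfR x)) (fun x => (div_le_one hbR).2 (hgR x)) ?_ ?_ ?_
  · have e1 : ∀ x, ENNReal.ofReal ((f x).toReal / a.toReal) = f x * a⁻¹ := by
      intro x
      rw [ENNReal.ofReal_div_of_pos haR, ENNReal.ofReal_toReal (ne_top_of_le_ne_top hfb (hfa x)),
        ENNReal.ofReal_toReal hfb, div_eq_mul_inv]
    have e2 : ∀ x, ENNReal.ofReal ((g x).toReal / b.toReal) = g x * b⁻¹ := by
      intro x
      rw [ENNReal.ofReal_div_of_pos hbR, ENNReal.ofReal_toReal (ne_top_of_le_ne_top hgb (hgb' x)),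
        ENNReal.ofReal_toReal hgb, div_eq_mul_inv]
    have e3 : ∀ x, ENNReal.ofReal ((min (u x) (ENNReal.ofReal c)).toReal / c) ≤
        u x * (ENNReal.ofReal c)⁻¹ := by
      intro x
      rw [ENNReal.ofReal_div_of_pos hc0, div_eq_mul_inv,
        ENNReal.ofReal_toReal (ne_top_of_le_ne_top ENNReal.ofReal_ne_top (min_le_right _ _))]
      gcongr
      exact min_le_left _ _
    simp only [e1, e2] at main
    have main2 := ENNReal.mul_le_sq_of_add_le
      (main.trans (mul_le_mul_right (lintegral_mono e3) 2))
    rw [lintegral_mul_const _ hf, lintegral_mul_const _ hg, lintegral_mul_const _ hu] at main2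
    have hab : a * b = ENNReal.ofReal c ^ 2 := by
      rw [← ENNReal.ofReal_pow hc0.le, hc2, ENNReal.ofReal_mul haR.le, ENNReal.ofReal_toReal hfb,
        ENNReal.ofReal_toReal hgb]
    have hc1 : ENNReal.ofReal c ≠ 0 := by simpa using hc0
    calc (∫⁻ x, f x) * (∫⁻ x, g x)
        = (a * a⁻¹) * (b * b⁻¹) * ((∫⁻ x, f x) * (∫⁻ x, g x)) := by
          rw [ENNReal.mul_inv_cancel ha0 hfb, ENNReal.mul_inv_cancel hb0 hgb]; simp
      _ = (a * b) * (((∫⁻ x, f x) * a⁻¹) * ((∫⁻ x, g x) * b⁻¹)) := by ring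
      _ ≤ (a * b) * (((∫⁻ x, u x) * (ENNReal.ofReal c)⁻¹) ^ 2) := by gcongr
      _ = (ENNReal.ofReal c * (ENNReal.ofReal c)⁻¹) ^ 2 * (∫⁻ x, u x) ^ 2 := by rw [hab]; ring
      _ = _ := by rw [ENNReal.mul_inv_cancel hc1 ENNReal.ofReal_ne_top]; simp
  · intro s hs
    rcases lt_or_ge s 0 with h0 | h0
    · exact ⟨0, h0.trans_le (by positivity)⟩
    have : ENNReal.ofReal (s * a.toReal) < a := by
      rw [ENNReal.ofReal_lt_iff_lt_toReal (by positivity) hfb]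
      nlinarith
    obtain ⟨x, hx⟩ := lt_iSup_iff.1 this
    refine ⟨x, (lt_div_iff₀ haR).2 ?_⟩
    rwa [ENNReal.ofReal_lt_iff_lt_toReal (by positivity)
      (ne_top_of_le_ne_top hfb (hfa x))] at hx
  · intro s hs
    rcases lt_or_ge s 0 with h0 | h0
    · exact ⟨0, h0.trans_le (by positivity)⟩
    have : ENNReal.ofReal (s * b.toReal) < b := by
      rw [ENNReal.ofReal_lt_iff_lt_toReal (by positivity) hgb]
      nlinarith
    obtain ⟨x, hx⟩ := lt_iSup_iff.1 this
    refine ⟨x, (lt_div_iff₀ hbR).2 ?_⟩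
    rwa [ENNReal.ofReal_lt_iff_lt_toReal (by positivity)
      (ne_top_of_le_ne_top hgb (hgb' x))] at hx
  · intro x y s hs hx hy
    have hs1 : s < 1 := hx.trans_le ((div_le_one haR).2 (hfR x))
    rw [lt_div_iff₀ haR] at hx
    rw [lt_div_iff₀ hbR] at hy
    rw [lt_div_iff₀ hc0, ← ENNReal.ofReal_lt_iff_lt_toReal (by positivity)
      (ne_top_of_le_ne_top ENNReal.ofReal_ne_top (min_le_right _ _)), lt_min_iff]
    refine ⟨?_, ?_⟩
    · refine (ENNReal.pow_lt_pow_left_iff two_ne_zero).1 (lt_of_lt_of_le ?_ (h x y))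
      rw [← ENNReal.ofReal_pow (by positivity), ← ENNReal.ofReal_toReal
        (ne_top_of_le_ne_top hfb (hfa x)), ← ENNReal.ofReal_toReal
        (ne_top_of_le_ne_top hgb (hgb' y)), ← ENNReal.ofReal_mul (by positivity),
        ENNReal.ofReal_lt_ofReal_iff_of_nonneg (by positivity), mul_pow, hc2]
      calc s ^ 2 * (a.toReal * b.toReal) = (s * a.toReal) * (s * b.toReal) := by ring
        _ < _ := mul_lt_mul'' hx hy (by positivity) (by positivity)
    · rw [ENNReal.ofReal_lt_ofReal_iff_of_nonneg (by positivity)]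
      nlinarith

theorem midpointPrekopaLeindler_real : MidpointPrekopaLeindler (volume : Measure ℝ) := by
  intro f g u hf hg hu h
  have trunc : ∀ k : ℝ → ℝ≥0∞, Measurable k →
      ∫⁻ x, k x = ⨆ N : ℕ, ∫⁻ x, min (k x) N := by
    intro k hk
    rw [← lintegral_iSup (fun N => hk.min measurable_const)
      (fun M N hMN x => min_le_min_left _ (by exact_mod_cast hMN))]
    refine lintegral_congr fun x => ?_
    rw [← inf_iSup_eq, ENNReal.iSup_natCast, inf_top_eq]
  have mono : ∀ k : ℝ → ℝ≥0∞, Monotone fun N : ℕ => ∫⁻ x, min (k x) N :=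
    fun k M N hMN => lintegral_mono fun x => min_le_min_left _ (by exact_mod_cast hMN)
  have bdd : ∀ (k : ℝ → ℝ≥0∞) (N : ℕ), ⨆ x, min (k x) N ≠ ⊤ := fun k N =>
    ne_top_of_le_ne_top (ENNReal.natCast_ne_top N) (iSup_le fun x => min_le_right _ _)
  rw [trunc f hf, trunc g hg, ENNReal.iSup_mul]
  refine iSup_le fun M => ?_
  rw [ENNReal.mul_iSup]
  refine iSup_le fun M' => le_trans (mul_le_mul' (mono f (le_max_left M M'))
    (mono g (le_max_right M M'))) ?_
  generalize max M M' = N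
  refine prekopaLeindler_real_of_bounded (hf.min measurable_const)
    (hg.min measurable_const) hu (bdd f N) (bdd g N) fun x y => le_trans ?_ (h x y)
  gcongr
  · exact min_le_left _ _
  · exact min_le_left _ _

lemma MidpointPrekopaLeindler.prod {F₁ F₂ : Type*} [AddCommGroup F₁] [Module ℝ F₁]
    [MeasurableSpace F₁] [AddCommGroup F₂] [Module ℝ F₂] [MeasurableSpace F₂]
    {μ : Measure F₁} {ν : Measure F₂} [SFinite ν]
    (hμ : MidpointPrekopaLeindler μ) (hν : MidpointPrekopaLeindler ν) :
    MidpointPrekopaLeindler (μ.prod ν) := by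
  intro f g u hf hg hu h
  rw [lintegral_prod _ hf.aemeasurable, lintegral_prod _ hg.aemeasurable,
    lintegral_prod _ hu.aemeasurable]
  refine hμ _ _ _ hf.lintegral_prod_right' hg.lintegral_prod_right' hu.lintegral_prod_right'
    fun x x' => ?_
  refine hν _ _ _ (hf.comp measurable_prodMk_left) (hg.comp measurable_prodMk_left)
    (hu.comp measurable_prodMk_left) fun y y' => ?_
  simpa using h (x, y) (x', y')

lemma MidpointPrekopaLeindler.of_measurePreserving {F₁ F₂ : Type*} [AddCommGroup F₁] [Module ℝ F₁]
    [MeasurableSpace F₁] [AddCommGroup F₂] [Module ℝ F₂] [MeasurableSpace F₂]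
    {μ : Measure F₁} {ν : Measure F₂} (hμ : MidpointPrekopaLeindler μ) (e : F₁ →ₗ[ℝ] F₂)
    (he : MeasurePreserving e μ ν) :
    MidpointPrekopaLeindler ν := by
  intro f g u hf hg hu h
  rw [← he.lintegral_comp hf, ← he.lintegral_comp hg, ← he.lintegral_comp hu]
  refine hμ _ _ _ (hf.comp he.measurable) (hg.comp he.measurable) (hu.comp he.measurable)
    fun x y => ?_
  simpa using h (e x) (e y)

theorem midpointPrekopaLeindler_pi (m : ℕ) :
    MidpointPrekopaLeindler (volume : Measure (Fin m → ℝ)) := by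
  induction m with
  | zero =>
    intro f g u _ _ _ h
    simp only [volume_pi, Measure.pi_of_empty _ (0 : Fin 0 → ℝ), lintegral_dirac]
    simpa using h 0 0
  | succ m ih =>
    have hp := (volume_preserving_piFinSuccAbove (fun _ : Fin (m + 1) => ℝ) 0).symm
    have he : ⇑(MeasurableEquiv.piFinSuccAbove (fun _ : Fin (m + 1) => ℝ) 0).symm =
        (Fin.consLinearEquiv ℝ (fun _ : Fin (m + 1) => ℝ)).toLinearMap := by
      funext x
      refine funext fun i => ?_
      refine Fin.cases ?_ (fun j => ?_) i
      · simp [Fin.consLinearEquiv]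
      · simp [Fin.consLinearEquiv]
    rw [he] at hp
    exact (midpointPrekopaLeindler_real.prod ih).of_measurePreserving _ hp

theorem midpointPrekopaLeindler_euclidean (m : ℕ) :
    MidpointPrekopaLeindler (volume : Measure (EuclideanSpace ℝ (Fin m))) :=
  (midpointPrekopaLeindler_pi m).of_measurePreserving
    (WithLp.linearEquiv 2 ℝ (Fin m → ℝ)).symm.toLinearMap
    (PiLp.volume_preserving_toLp (Fin m))

open Filter Topology in
/-- A second-order consequence of a Prékopa–Leindler type inequality: a centred function whose
exponential moments satisfy the inequality has its variance controlled by the second-order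
term of the majorant. -/
lemma integral_sq_le_of_exp_moments {Ω : Type*} [MeasurableSpace Ω] {ν : Measure Ω}
    [IsFiniteMeasure ν] {p q : Ω → ℝ} {δ : ℝ → Ω → ℝ} {C : ℝ}
    (hpm : AEStronglyMeasurable p ν) (hexp : Integrable (fun ω => Real.exp (4 * |p ω|)) ν)
    (hp0 : ∫ ω, p ω ∂ν = 0) (hδm : ∀ t, AEStronglyMeasurable (δ t) ν)
    (hδ : ∀ t ω, |δ t ω| ≤ C * t ^ 2)
    (hlim : ∀ᵐ ω ∂ν, Tendsto (fun t => δ t ω / t ^ 2) (𝓝[>] 0) (𝓝 (q ω / 2)))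
    (hPL : ∀ t, 0 < t → t < 1 → (∫ ω, Real.exp (t * p ω) ∂ν) * (∫ ω, Real.exp (-t * p ω) ∂ν) ≤
      (∫ ω, Real.exp (δ t ω) ∂ν) ^ 2) :
    ∫ ω, p ω ^ 2 ∂ν ≤ ∫ ω, q ω ∂ν := by
  rcases eq_zero_or_neZero ν with rfl | hν
  · simp
  set Z : ℝ := ν.real Set.univ with hZ
  have hZ0 : 0 < Z := measureReal_univ_pos
  have hC : 0 ≤ C := by
    obtain ⟨ω⟩ : Nonempty Ω := ν.nonempty_of_neZero
    have := (abs_nonneg _).trans (hδ 1 ω)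
    simpa using this
  have hle : ∀ ω, |p ω| ≤ Real.exp |p ω| := fun ω => by
    linarith [Real.add_one_le_exp |p ω|]
  have hinteg : ∀ f : Ω → ℝ, AEStronglyMeasurable f ν → (∀ ω, |f ω| ≤ Real.exp (4 * |p ω|)) →
      Integrable f ν := fun f hf h => hexp.mono' hf (.of_forall h)
  have hpow : ∀ ω (k : ℕ), k ≤ 4 → Real.exp |p ω| ^ k ≤ Real.exp (4 * |p ω|) := by
    intro ω k hk
    rw [← Real.exp_nat_mul]
    apply Real.exp_le_exp.2
    have : (k : ℝ) ≤ 4 := by exact_mod_cast hk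
    nlinarith [abs_nonneg (p ω)]
  have hi1 : Integrable p ν := hinteg _ hpm fun ω => by
    simpa using (hle ω).trans (by simpa using hpow ω 1 (by norm_num))
  have hi2 : Integrable (fun ω => p ω ^ 2) ν := hinteg _ (hpm.pow 2) fun ω => by
    rw [abs_pow]
    exact (pow_le_pow_left₀ (abs_nonneg _) (hle ω) 2).trans (hpow ω 2 (by norm_num))
  have hi3 : Integrable (fun ω => |p ω| ^ 3 * Real.exp |p ω|) ν := by
    refine hinteg _ ((hpm.norm.pow 3).mul (Real.continuous_exp.comp_aestronglyMeasurable hpm.norm))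
      fun ω => ?_
    rw [abs_of_nonneg (by positivity)]
    calc |p ω| ^ 3 * Real.exp |p ω| ≤ Real.exp |p ω| ^ 3 * Real.exp |p ω| := by
          gcongr; exact hle ω
      _ = Real.exp |p ω| ^ 4 := by ring
      _ ≤ _ := hpow ω 4 le_rfl
  set A := ∫ ω, p ω ^ 2 ∂ν with hA
  set B := ∫ ω, |p ω| ^ 3 * Real.exp |p ω| ∂ν with hB
  have hB0 : 0 ≤ B := integral_nonneg fun ω => by positivity
  have hlow : ∀ t : ℝ, |t| < 1 → Z + t ^ 2 * (A / 2) - |t| ^ 3 * B ≤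
      ∫ ω, Real.exp (t * p ω) ∂ν := by
    intro t ht
    have e : Z + t ^ 2 * (A / 2) - |t| ^ 3 * B =
        ∫ ω, (1 + t * p ω + t ^ 2 / 2 * p ω ^ 2 - |t| ^ 3 * (|p ω| ^ 3 * Real.exp |p ω|)) ∂ν := by
      have j1 : Integrable (fun ω => 1 + t * p ω) ν := (integrable_const _).add (hi1.const_mul _)
      have j2 : Integrable (fun ω => 1 + t * p ω + t ^ 2 / 2 * p ω ^ 2) ν :=
        j1.add (hi2.const_mul _)
      rw [integral_sub j2 (hi3.const_mul _), integral_add j1 (hi2.const_mul _),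
        integral_add (integrable_const _) (hi1.const_mul _)]
      simp only [integral_const_mul, hp0, integral_const]
      simp
      ring
    rw [e]
    refine integral_mono ((((integrable_const _).add (hi1.const_mul _)).add
      (hi2.const_mul _)).sub (hi3.const_mul _)) (hinteg _ ?_ fun ω => ?_) fun ω => ?_
    · exact Real.continuous_exp.comp_aestronglyMeasurable (hpm.const_mul t)
    · rw [abs_of_pos (Real.exp_pos _)]
      apply Real.exp_le_exp.2
      have := abs_mul t (p ω)
      nlinarith [le_abs_self (t * p ω), abs_nonneg (p ω)]
    · have h1 := Complex.norm_exp_sub_sum_le_norm_mul_exp ((t * p ω : ℝ) : ℂ) 3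
      have h2 : Complex.exp ((t * p ω : ℝ) : ℂ) -
          ∑ m ∈ Finset.range 3, ((t * p ω : ℝ) : ℂ) ^ m / (m.factorial : ℂ) =
          ((Real.exp (t * p ω) - (1 + t * p ω + t ^ 2 / 2 * p ω ^ 2) : ℝ) : ℂ) := by
        simp [Finset.sum_range_succ, Nat.factorial]
        ring
      rw [h2, Complex.norm_real, Complex.norm_real, Real.norm_eq_abs, Real.norm_eq_abs] at h1
      have h3 := (abs_le.1 h1).1
      have h4 : |t * p ω| ^ 3 * Real.exp |t * p ω| ≤ |t| ^ 3 * (|p ω| ^ 3 * Real.exp |p ω|) := by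
        rw [abs_mul, mul_pow, mul_assoc]
        gcongr
        nlinarith [abs_nonneg (p ω)]
      simp only
      linarith
  set D : ℝ → ℝ := fun t => ∫ ω, δ t ω / t ^ 2 ∂ν with hD
  have hDlim : Tendsto D (𝓝[>] 0) (𝓝 (∫ ω, q ω / 2 ∂ν)) := by
    refine tendsto_integral_filter_of_dominated_convergence (fun _ => C) ?_ ?_
      (integrable_const _) hlim
    · exact .of_forall fun t => ((hδm t).mul_const (t ^ 2)⁻¹).congr (.of_forall fun ω => by
        simp [div_eq_mul_inv])
    · filter_upwards [self_mem_nhdsWithin] with t ht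
      refine .of_forall fun ω => ?_
      have : (0 : ℝ) < t ^ 2 := pow_pos ht 2
      rw [Real.norm_eq_abs, abs_div, abs_of_pos this, div_le_iff₀ this]
      exact hδ t ω
  have hδi : ∀ t, Integrable (δ t) ν := fun t =>
    (integrable_const (C * t ^ 2)).mono' (hδm t) (.of_forall (hδ t))
  have hup : ∀ t : ℝ, 0 < t → C * t ^ 2 ≤ 1 → ∫ ω, Real.exp (δ t ω) ∂ν ≤
      Z + t ^ 2 * (D t + C ^ 2 * t ^ 2 * Z) := by
    intro t ht hCt
    have e : Z + t ^ 2 * (D t + C ^ 2 * t ^ 2 * Z) =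
        ∫ ω, (1 + δ t ω + (C * t ^ 2) ^ 2) ∂ν := by
      have j1 : Integrable (fun ω => 1 + δ t ω) ν := (integrable_const _).add (hδi t)
      rw [integral_add j1 (integrable_const _),
        integral_add (integrable_const _) (hδi t)]
      simp only [hD, integral_div, integral_const]
      simp
      field_simp
      ring
    rw [e]
    refine integral_mono ((integrable_const (Real.exp (C * t ^ 2))).mono'
      (Real.continuous_exp.comp_aestronglyMeasurable (hδm t)) (.of_forall fun ω => ?_))
      (((integrable_const _).add (hδi t)).add (integrable_const _)) fun ω => ?_
    · rw [Real.norm_eq_abs, abs_of_pos (Real.exp_pos _)]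
      exact Real.exp_le_exp.2 ((le_abs_self _).trans (hδ t ω))
    · have h1 := Real.abs_exp_sub_one_sub_id_le ((hδ t ω).trans hCt)
      have h2 := (abs_le.1 h1).2
      have h3 : δ t ω ^ 2 ≤ (C * t ^ 2) ^ 2 := sq_le_sq' (by linarith [(abs_le.1 (hδ t ω)).1])
        (abs_le.1 (hδ t ω)).2
      simp only
      linarith
  have hfin : ∀ᶠ t in 𝓝[>] (0 : ℝ), Z * A + t ^ 2 * (A / 2) ^ 2 - 2 * t * B * (Z + t ^ 2 * (A / 2))
      + t ^ 4 * B ^ 2 ≤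
      2 * Z * (D t + C ^ 2 * t ^ 2 * Z) + t ^ 2 * (D t + C ^ 2 * t ^ 2 * Z) ^ 2 := by
    have c1 : ∀ᶠ t in 𝓝[>] (0 : ℝ), C * t ^ 2 < 1 := by
      have : Tendsto (fun t : ℝ => C * t ^ 2) (𝓝[>] 0) (𝓝 (C * 0 ^ 2)) :=
        ((by fun_prop : Continuous fun t : ℝ => C * t ^ 2).tendsto 0).mono_left nhdsWithin_le_nhds
      exact this.eventually_lt_const (by simp)
    have c2 : ∀ᶠ t in 𝓝[>] (0 : ℝ), 0 < Z + t ^ 2 * (A / 2) - t ^ 3 * B := by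
      have : Tendsto (fun t : ℝ => Z + t ^ 2 * (A / 2) - t ^ 3 * B) (𝓝[>] 0)
          (𝓝 (Z + 0 ^ 2 * (A / 2) - 0 ^ 3 * B)) :=
        ((by fun_prop : Continuous fun t : ℝ => Z + t ^ 2 * (A / 2) - t ^ 3 * B).tendsto
          0).mono_left nhdsWithin_le_nhds
      exact this.eventually_const_lt (by simpa using hZ0)
    filter_upwards [c1, c2, Ioo_mem_nhdsGT (zero_lt_one' ℝ)] with t h1 h2 ht
    have htp : 0 < t := ht.1
    have l1 := hlow t (by rw [abs_of_pos htp]; exact ht.2)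
    have l2 := hlow (-t) (by rw [abs_neg, abs_of_pos htp]; exact ht.2)
    rw [abs_of_pos htp] at l1
    rw [abs_neg, abs_of_pos htp, neg_sq] at l2
    have l3 := hup t htp h1.le
    have l4 := hPL t htp ht.2
    have l5 : (Z + t ^ 2 * (A / 2) - t ^ 3 * B) * (Z + t ^ 2 * (A / 2) - t ^ 3 * B) ≤
        (Z + t ^ 2 * (D t + C ^ 2 * t ^ 2 * Z)) ^ 2 :=
      (mul_le_mul l1 l2 h2.le (h2.le.trans l1)).trans (l4.trans
        (pow_le_pow_left₀ (integral_nonneg fun ω => (Real.exp_pos _).le) l3 2))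
    have h5 : (0 : ℝ) < t ^ 2 := by positivity
    refine le_of_mul_le_mul_left ?_ h5
    nlinarith
  have hD' : Tendsto (fun t => D t + C ^ 2 * t ^ 2 * Z) (𝓝[>] 0) (𝓝 (∫ ω, q ω / 2 ∂ν)) := by
    have : Tendsto (fun t : ℝ => C ^ 2 * t ^ 2 * Z) (𝓝[>] 0) (𝓝 (C ^ 2 * 0 ^ 2 * Z)) :=
      ((by fun_prop : Continuous fun t : ℝ => C ^ 2 * t ^ 2 * Z).tendsto 0).mono_left
        nhdsWithin_le_nhds
    simpa using hDlim.add this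
  have ht0 : Tendsto (fun t : ℝ => t) (𝓝[>] 0) (𝓝 0) := nhdsWithin_le_nhds
  have hR := (hD'.const_mul (2 * Z)).add ((ht0.pow 2).mul (hD'.pow 2))
  have hL : Tendsto (fun t : ℝ => Z * A + t ^ 2 * (A / 2) ^ 2 - 2 * t * B * (Z + t ^ 2 * (A / 2))
      + t ^ 4 * B ^ 2) (𝓝[>] 0) (𝓝 (Z * A)) := by
    have := ((by fun_prop : Continuous fun t : ℝ => Z * A + t ^ 2 * (A / 2) ^ 2 -
      2 * t * B * (Z + t ^ 2 * (A / 2)) + t ^ 4 * B ^ 2).tendsto 0).mono_left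
      (nhdsWithin_le_nhds (s := Set.Ioi (0 : ℝ)))
    simpa using this
  have := le_of_tendsto_of_tendsto hL hR hfin
  rw [integral_div] at this
  have h7 : Z * A ≤ Z * ∫ ω, q ω ∂ν := by linarith
  exact le_of_mul_le_mul_left h7 hZ0

/-- A positively `0`-homogeneous function which is continuous away from the origin is bounded. -/
lemma exists_bound_of_homogeneous {n : ℕ} {F : Type*} [NormedAddCommGroup F] {f : E n → F}
    (hf : ContinuousOn f {0}ᶜ) (hhom : ∀ (t : ℝ) (x : E n), 0 < t → x ≠ 0 → f (t • x) = f x) :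
    ∃ C, 0 ≤ C ∧ ∀ x, x ≠ 0 → ‖f x‖ ≤ C := by
  have hsub : sphere (0 : E n) 1 ⊆ {0}ᶜ := fun x hx => by
    have : ‖x‖ = 1 := by simpa using hx
    simpa using norm_ne_zero_iff.1 (by rw [this]; norm_num)
  obtain ⟨C, hC⟩ := (isCompact_sphere (0 : E n) 1).exists_bound_of_continuousOn (hf.mono hsub)
  refine ⟨max C 0, le_max_right _ _, fun x hx => ?_⟩
  have hx' : 0 < ‖x‖ := norm_pos_iff.2 hx
  rw [← hhom ‖x‖⁻¹ x (inv_pos.2 hx') hx]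
  refine (hC _ ?_).trans (le_max_left _ _)
  simp [hx'.ne', norm_smul]

/-- Half the square of a smooth, strictly convex gauge: positively `2`-homogeneous, smooth and
with positive definite Hessian away from the origin. -/
structure IsQuadGauge {n : ℕ} (ψ : E n → ℝ) : Prop where
  hom : ∀ (t : ℝ) (x : E n), 0 < t → ψ (t • x) = t ^ 2 * ψ x
  smooth : ContDiffOn ℝ (⊤ : ℕ∞) ψ {(0 : E n)}ᶜ
  posDef : ∀ x, x ≠ 0 → ∀ v, v ≠ 0 → 0 < ⟪hess ψ x v, v⟫

lemma contDiffOn_gradient {n : ℕ} {ψ : E n → ℝ} (h : ContDiffOn ℝ (⊤ : ℕ∞) ψ {(0 : E n)}ᶜ) :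
    ContDiffOn ℝ (⊤ : ℕ∞) (gradient ψ) {(0 : E n)}ᶜ :=
  (InnerProductSpace.toDual ℝ (E n)).symm.contDiff.comp_contDiffOn
    (h.fderiv_of_isOpen isOpen_compl_singleton (by simp))

lemma hasFDerivAt_gradient {n : ℕ} {ψ : E n → ℝ} (h : ContDiffOn ℝ (⊤ : ℕ∞) ψ {(0 : E n)}ᶜ)
    {x : E n} (hx : x ≠ 0) : HasFDerivAt (gradient ψ) (hess ψ x) x :=
  (((contDiffOn_gradient h).contDiffAt (isOpen_compl_singleton.mem_nhds hx)).differentiableAt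
    (by simp)).hasFDerivAt

lemma hasGradientAt_of_contDiffOn {n : ℕ} {ψ : E n → ℝ}
    (h : ContDiffOn ℝ (⊤ : ℕ∞) ψ {(0 : E n)}ᶜ) {x : E n} (hx : x ≠ 0) :
    HasGradientAt ψ (gradient ψ x) x :=
  ((h.contDiffAt (isOpen_compl_singleton.mem_nhds hx)).differentiableAt (by simp)).hasGradientAt

lemma continuousOn_hess {n : ℕ} {ψ : E n → ℝ} (h : ContDiffOn ℝ (⊤ : ℕ∞) ψ {(0 : E n)}ᶜ) :
    ContinuousOn (hess ψ) {0}ᶜ :=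
  (contDiffOn_gradient h).continuousOn_fderiv_of_isOpen isOpen_compl_singleton (by simp)

lemma inner_hess_comm {n : ℕ} {ψ : E n → ℝ} (h : ContDiffOn ℝ (⊤ : ℕ∞) ψ {(0 : E n)}ᶜ)
    {x : E n} (hx : x ≠ 0) (u v : E n) : ⟪hess ψ x u, v⟫ = ⟪u, hess ψ x v⟫ := by
  have hev : ∀ᶠ y in nhds x, HasFDerivAt ψ (innerSL ℝ (gradient ψ y)) y := by
    filter_upwards [isOpen_compl_singleton.mem_nhds hx] with y hy
    exact (hasGradientAt_of_contDiffOn h hy).hasFDerivAt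
  have h2 : HasFDerivAt (fun y => innerSL ℝ (gradient ψ y)) ((innerSL ℝ).comp (hess ψ x)) x :=
    (innerSL ℝ).hasFDerivAt.comp x (hasFDerivAt_gradient h hx)
  have := second_derivative_symmetric_of_eventually hev h2 u v
  simp only [ContinuousLinearMap.comp_apply, innerSL_apply_apply] at this
  rw [this, real_inner_comm]

namespace IsQuadGauge

variable {n : ℕ} {ψ : E n → ℝ}

lemma map_zero (h : IsQuadGauge ψ) : ψ 0 = 0 := by
  have := h.hom 2 0 (by norm_num)
  rw [smul_zero] at this
  linarith

lemma gradient_smul (h : IsQuadGauge ψ) {t : ℝ} (ht : 0 < t) (x : E n) :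
    gradient ψ (t • x) = t • gradient ψ x := by
  have e : (fun y => ψ (t • y)) = fun y => t ^ 2 • ψ y := funext fun y => h.hom t y ht
  have h1 : fderiv ℝ (fun y => ψ (t • y)) x = t • fderiv ℝ ψ (t • x) := fderiv_comp_smul t
  have h2 : fderiv ℝ (fun y => t ^ 2 • ψ y) x = t ^ 2 • fderiv ℝ ψ x := by
    exact congrFun (fderiv_const_smul_field (𝕜 := ℝ) (R := ℝ) (f := ψ) (t ^ 2)) x
  rw [e, h2] at h1
  have h3 : fderiv ℝ ψ (t • x) = t • fderiv ℝ ψ x := by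
    apply smul_right_injective _ ht.ne'
    simp only
    rw [← h1, smul_smul, sq]
  rw [gradient, gradient, h3, LinearIsometryEquiv.map_smulₛₗ]
  simp

lemma gradient_zero (h : IsQuadGauge ψ) : gradient ψ 0 = 0 := by
  have := h.gradient_smul (t := 2) (by norm_num) 0
  rw [smul_zero, two_smul] at this
  simpa using this

lemma hess_smul (h : IsQuadGauge ψ) {t : ℝ} (ht : 0 < t) (x : E n) :
    hess ψ (t • x) = hess ψ x := by
  have e : (fun y => gradient ψ (t • y)) = fun y => t • gradient ψ y :=
    funext fun y => h.gradient_smul ht y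
  have h1 : fderiv ℝ (fun y => gradient ψ (t • y)) x = t • fderiv ℝ (gradient ψ) (t • x) :=
    fderiv_comp_smul t
  have h2 : fderiv ℝ (fun y => t • gradient ψ y) x = t • fderiv ℝ (gradient ψ) x := by
    exact congrFun (fderiv_const_smul_field (𝕜 := ℝ) (R := ℝ) (f := gradient ψ) t) x
  rw [e, h2] at h1
  exact (smul_right_injective _ ht.ne' h1).symm

lemma hasGradientAt (h : IsQuadGauge ψ) {x : E n} (hx : x ≠ 0) :
    HasGradientAt ψ (gradient ψ x) x :=
  hasGradientAt_of_contDiffOn h.smooth hx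

lemma inner_gradient_self (h : IsQuadGauge ψ) (x : E n) : ⟪gradient ψ x, x⟫ = 2 * ψ x := by
  rcases eq_or_ne x 0 with rfl | hx
  · simp [h.map_zero]
  have hc : HasDerivAt (fun t : ℝ => t • x) x 1 := by
    simpa using (hasDerivAt_id (1 : ℝ)).smul_const x
  have h1 : HasDerivAt (fun t : ℝ => ψ (t • x)) ⟪gradient ψ x, x⟫ 1 := by
    have := (h.hasGradientAt (x := (1 : ℝ) • x) (by simpa)).hasFDerivAt.comp_hasDerivAt 1 hc
    simpa [Function.comp_def] using this
  have h2 : HasDerivAt (fun t : ℝ => ψ (t • x)) (2 * ψ x) 1 := by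
    have : HasDerivAt (fun t : ℝ => t ^ 2 * ψ x) (2 * ψ x) 1 := by
      simpa using (hasDerivAt_pow 2 (1 : ℝ)).mul_const (ψ x)
    refine this.congr_of_eventuallyEq ?_
    filter_upwards [lt_mem_nhds (zero_lt_one' ℝ)] with t ht
    exact h.hom t x ht
  exact h1.unique h2

lemma hess_self (h : IsQuadGauge ψ) {x : E n} (hx : x ≠ 0) : hess ψ x x = gradient ψ x := by
  have hc : HasDerivAt (fun t : ℝ => t • x) x 1 := by
    simpa using (hasDerivAt_id (1 : ℝ)).smul_const x
  have h1 : HasDerivAt (fun t : ℝ => gradient ψ (t • x)) (hess ψ x x) 1 := by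
    have := (hasFDerivAt_gradient h.smooth (x := (1 : ℝ) • x) (by simpa)).comp_hasDerivAt 1 hc
    simpa [Function.comp_def] using this
  have h2 : HasDerivAt (fun t : ℝ => gradient ψ (t • x)) (gradient ψ x) 1 := by
    have : HasDerivAt (fun t : ℝ => t • gradient ψ x) (gradient ψ x) 1 := by
      simpa using (hasDerivAt_id (1 : ℝ)).smul_const (gradient ψ x)
    refine this.congr_of_eventuallyEq ?_
    filter_upwards [lt_mem_nhds (zero_lt_one' ℝ)] with t ht
    exact h.gradient_smul ht x
  exact h1.unique h2

lemma pos (h : IsQuadGauge ψ) {x : E n} (hx : x ≠ 0) : 0 < ψ x := by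
  have := h.posDef x hx x hx
  rw [h.hess_self hx, h.inner_gradient_self] at this
  linarith

lemma nonneg (h : IsQuadGauge ψ) (x : E n) : 0 ≤ ψ x := by
  rcases eq_or_ne x 0 with rfl | hx
  · exact h.map_zero.ge
  · exact (h.pos hx).le

lemma exists_bound_hess (h : IsQuadGauge ψ) : ∃ C, 0 ≤ C ∧ ∀ x, x ≠ 0 → ‖hess ψ x‖ ≤ C :=
  exists_bound_of_homogeneous (continuousOn_hess h.smooth) fun _ x ht _ => h.hess_smul ht x

lemma exists_bound_gradient (h : IsQuadGauge ψ) : ∃ C, 0 ≤ C ∧ ∀ x, ‖gradient ψ x‖ ≤ C * ‖x‖ := by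
  obtain ⟨C, hC, hb⟩ := h.exists_bound_hess
  refine ⟨C, hC, fun x => ?_⟩
  rcases eq_or_ne x 0 with rfl | hx
  · simp [h.gradient_zero]
  rw [← h.hess_self hx]
  exact (hess ψ x).le_of_opNorm_le (hb x hx) x

lemma le_bound (h : IsQuadGauge ψ) : ∃ C, 0 ≤ C ∧ ∀ x, ψ x ≤ C * ‖x‖ ^ 2 := by
  obtain ⟨C, hC, hb⟩ := h.exists_bound_gradient
  refine ⟨C, hC, fun x => ?_⟩
  have h1 := real_inner_le_norm (gradient ψ x) x
  rw [h.inner_gradient_self] at h1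
  have h2 := mul_le_mul_of_nonneg_right (hb x) (norm_nonneg x)
  nlinarith [h.nonneg x]

lemma exists_lower_bound (h : IsQuadGauge ψ) : ∃ c, 0 < c ∧ ∀ x, c * ‖x‖ ^ 2 ≤ ψ x := by
  have hcont : ContinuousOn (fun x => ‖x‖ ^ 2 / ψ x) {(0 : E n)}ᶜ :=
    (continuous_norm.pow 2).continuousOn.div h.smooth.continuousOn fun x hx => (h.pos hx).ne'
  obtain ⟨C, hC, hb⟩ := exists_bound_of_homogeneous hcont fun t x ht hx => by
    rw [h.hom t x ht, norm_smul, mul_pow, Real.norm_eq_abs, sq_abs,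
      mul_div_mul_left _ _ (by positivity)]
  refine ⟨(C + 1)⁻¹, by positivity, fun x => ?_⟩
  rcases eq_or_ne x 0 with rfl | hx
  · simp [h.map_zero]
  have h1 := hb x hx
  have h2 := h.pos hx
  rw [Real.norm_eq_abs, abs_of_nonneg (by positivity), div_le_iff₀ h2] at h1
  rw [inv_mul_le_iff₀ (by positivity)]
  nlinarith

lemma hasGradientAt_zero (h : IsQuadGauge ψ) : HasGradientAt ψ 0 0 := by
  obtain ⟨C, hC, hb⟩ := h.le_bound
  rw [hasGradientAt_iff_isLittleO]
  refine Asymptotics.IsBigO.trans_isLittleO (g := fun x : E n => ‖x‖ ^ 2) ?_ ?_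
  · refine Asymptotics.IsBigO.of_bound C (.of_forall fun x => ?_)
    simp only [h.map_zero, inner_zero_left, sub_zero]
    rw [Real.norm_eq_abs, abs_of_nonneg (h.nonneg x), Real.norm_eq_abs, abs_of_nonneg (by positivity)]
    exact hb x
  · simpa using Asymptotics.isLittleO_norm_pow_id (E' := E n) one_lt_two

lemma hasGradientAt' (h : IsQuadGauge ψ) (x : E n) : HasGradientAt ψ (gradient ψ x) x := by
  rcases eq_or_ne x 0 with rfl | hx
  · rw [h.gradient_zero]; exact h.hasGradientAt_zero
  · exact h.hasGradientAt hx

lemma continuous (h : IsQuadGauge ψ) : Continuous ψ :=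
  continuous_iff_continuousAt.2 fun x => (h.hasGradientAt' x).continuousAt

lemma continuous_gradient (h : IsQuadGauge ψ) : Continuous (gradient ψ) := by
  refine continuous_iff_continuousAt.2 fun x => ?_
  rcases eq_or_ne x 0 with rfl | hx
  · obtain ⟨C, hC, hb⟩ := h.exists_bound_gradient
    rw [ContinuousAt, h.gradient_zero]
    refine squeeze_zero_norm hb ?_
    simpa using (by fun_prop : Continuous fun x : E n => C * ‖x‖).tendsto 0
  · exact (hasFDerivAt_gradient h.smooth hx).continuousAt

end IsQuadGauge

namespace IsQuadGauge

variable {n : ℕ} {ψ : E n → ℝ}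

lemma hasDerivAt_line (h : IsQuadGauge ψ) (a w : E n) (s : ℝ) :
    HasDerivAt (fun s : ℝ => ψ (a + s • w)) ⟪gradient ψ (a + s • w), w⟫ s := by
  have hc : HasDerivAt (fun t : ℝ => a + t • w) w s := by
    simpa using ((hasDerivAt_id s).smul_const w).const_add a
  have := (h.hasGradientAt' (a + s • w)).hasFDerivAt.comp_hasDerivAt s hc
  simpa [Function.comp_def] using this

lemma hasDerivAt_gradient_line (h : IsQuadGauge ψ) (a w : E n) {s : ℝ} (hs : a + s • w ≠ 0) :
    HasDerivAt (fun s : ℝ => ⟪gradient ψ (a + s • w), w⟫) ⟪hess ψ (a + s • w) w, w⟫ s := by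
  have hc : HasDerivAt (fun t : ℝ => a + t • w) w s := by
    simpa using ((hasDerivAt_id s).smul_const w).const_add a
  have h1 := (hasFDerivAt_gradient h.smooth hs).comp_hasDerivAt s hc
  simpa [Function.comp_def] using h1.inner ℝ (hasDerivAt_const s w)

lemma strictMonoOn_line (h : IsQuadGauge ψ) {a w : E n} (hw : w ≠ 0)
    (hs : ∀ s ∈ Set.Icc (0 : ℝ) 1, a + s • w ≠ 0) :
    StrictMonoOn (fun s : ℝ => ⟪gradient ψ (a + s • w), w⟫) (Set.Icc 0 1) := by
  refine strictMonoOn_of_deriv_pos (convex_Icc _ _) ?_ fun s hs' => ?_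
  · have := h.continuous_gradient
    exact Continuous.continuousOn (by fun_prop)
  · have hs0 := hs s (interior_subset hs')
    rw [(h.hasDerivAt_gradient_line a w hs0).deriv]
    exact h.posDef _ hs0 w hw

/-- The gradient inequality for the convex function `ψ`. -/
lemma add_inner_gradient_le (h : IsQuadGauge ψ) (a b : E n) :
    ψ a + ⟪gradient ψ a, b - a⟫ ≤ ψ b := by
  by_cases hab : b - a = 0
  · rw [sub_eq_zero.1 hab]; simp
  by_cases hs : ∀ s ∈ Set.Icc (0 : ℝ) 1, a + s • (b - a) ≠ 0
  · obtain ⟨c, hc, hc'⟩ := exists_hasDerivAt_eq_slope (fun s : ℝ => ψ (a + s • (b - a)))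
      (fun s : ℝ => ⟪gradient ψ (a + s • (b - a)), b - a⟫) zero_lt_one
      (by have := h.continuous; exact Continuous.continuousOn (by fun_prop))
      (fun s _ => h.hasDerivAt_line a (b - a) s)
    have hm := (h.strictMonoOn_line hab hs) (Set.left_mem_Icc.2 zero_le_one)
      (Set.Ioo_subset_Icc_self hc) hc.1
    simp only [zero_smul, add_zero, one_smul, add_sub_cancel, sub_zero, div_one] at hm hc'
    linarith
  · push Not at hs
    obtain ⟨s, ⟨hs0, hs1⟩, hs⟩ := hs
    have h1 : ⟪gradient ψ a, a⟫ + s * ⟪gradient ψ a, b - a⟫ = 0 := by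
      rw [← inner_smul_right, ← inner_add_right, hs, inner_zero_right]
    rw [h.inner_gradient_self] at h1
    have h2 := h.nonneg a
    have h3 := h.nonneg b
    rcases hs0.eq_or_lt with rfl | hs0
    · have : a = 0 := by simpa using hs
      simp [this, h.gradient_zero, h.map_zero, h3]
    · have : ⟪gradient ψ a, b - a⟫ ≤ -2 * ψ a := by
        by_contra hcon
        push Not at hcon
        nlinarith
      linarith

/-- Young's inequality. -/
lemma inner_gradient_le (h : IsQuadGauge ψ) (a b : E n) : ⟪gradient ψ a, b⟫ ≤ ψ a + ψ b := by
  have h1 := h.add_inner_gradient_le a b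
  rw [inner_sub_right, h.inner_gradient_self] at h1
  linarith

lemma eq_zero_of_gradient_eq_zero (h : IsQuadGauge ψ) {x : E n} (hx : gradient ψ x = 0) :
    x = 0 := by
  by_contra hx0
  have h1 := h.inner_gradient_self x
  have h2 := h.pos hx0
  rw [hx, inner_zero_left] at h1
  linarith

lemma gradient_injective (h : IsQuadGauge ψ) : Function.Injective (gradient ψ) := by
  intro a b hab
  by_contra hne
  have hw : b - a ≠ 0 := sub_ne_zero.2 (Ne.symm hne)
  by_cases ha : a = 0
  · subst ha
    rw [h.gradient_zero] at hab
    exact hne (h.eq_zero_of_gradient_eq_zero hab.symm).symm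
  by_cases hb : b = 0
  · subst hb
    rw [h.gradient_zero] at hab
    exact hne (h.eq_zero_of_gradient_eq_zero hab)
  by_cases hs : ∀ s ∈ Set.Icc (0 : ℝ) 1, a + s • (b - a) ≠ 0
  · have hm := (h.strictMonoOn_line hw hs) (Set.left_mem_Icc.2 zero_le_one)
      (Set.right_mem_Icc.2 zero_le_one) zero_lt_one
    simp [hab] at hm
  · push Not at hs
    obtain ⟨s, ⟨hs0, hs1⟩, hs⟩ := hs
    have h1 : ⟪gradient ψ a, a⟫ + s * ⟪gradient ψ a, b - a⟫ = 0 := by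
      rw [← inner_smul_right, ← inner_add_right, hs, inner_zero_right]
    have h2 : ⟪gradient ψ a, b⟫ = ⟪gradient ψ a, a⟫ + ⟪gradient ψ a, b - a⟫ := by
      rw [← inner_add_right, add_sub_cancel]
    have h3 : ⟪gradient ψ a, b⟫ = 2 * ψ b := by rw [hab, h.inner_gradient_self]
    rw [h.inner_gradient_self] at h1 h2
    have h4 := h.pos ha
    have h5 := h.pos hb
    have h6 : ⟪gradient ψ a, b - a⟫ < 0 := by
      by_contra hcon
      push Not at hcon
      nlinarith
    nlinarith

lemma gradient_surjective (h : IsQuadGauge ψ) : Function.Surjective (gradient ψ) := by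
  intro z
  obtain ⟨c, hc, hcb⟩ := h.exists_lower_bound
  have hcont : Continuous fun x => ψ x - ⟪z, x⟫ := by
    have := h.continuous
    fun_prop
  have hlim : Filter.Tendsto (fun x => ψ x - ⟪z, x⟫) (Filter.cocompact (E n)) Filter.atTop := by
    have h1 : Filter.Tendsto (fun r : ℝ => r * (c * r - ‖z‖)) Filter.atTop Filter.atTop :=
      Filter.tendsto_id.atTop_mul_atTop₀
        (Filter.tendsto_atTop_add_const_right _ _ (Filter.tendsto_id.const_mul_atTop hc))
    refine Filter.tendsto_atTop_mono (fun x => ?_) (h1.comp tendsto_norm_cocompact_atTop)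
    have h2 := hcb x
    have h3 := real_inner_le_norm z x
    simp only [Function.comp_apply]
    nlinarith
  obtain ⟨x, hx⟩ := hcont.exists_forall_le hlim
  refine ⟨x, ?_⟩
  have hmin : IsLocalMin (fun x => ψ x - ⟪z, x⟫) x := .of_forall hx
  have hd : HasFDerivAt (fun x => ψ x - ⟪z, x⟫) (innerSL ℝ (gradient ψ x) - innerSL ℝ z) x :=
    (h.hasGradientAt' x).hasFDerivAt.sub (innerSL ℝ z).hasFDerivAt
  have h0 := hmin.hasFDerivAt_eq_zero hd
  refine ext_inner_right ℝ fun v => sub_eq_zero.1 ?_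
  exact DFunLike.congr_fun h0 v

lemma exists_lipschitz_gradient (h : IsQuadGauge ψ) :
    ∃ L, 0 ≤ L ∧ ∀ a b, ‖gradient ψ b - gradient ψ a‖ ≤ L * ‖b - a‖ := by
  obtain ⟨C₁, hC₁, hb₁⟩ := h.exists_bound_hess
  obtain ⟨C₂, hC₂, hb₂⟩ := h.exists_bound_gradient
  refine ⟨max C₁ C₂, hC₁.trans (le_max_left _ _), fun a b => ?_⟩
  by_cases hs : ∀ s ∈ Set.Icc (0 : ℝ) 1, a + s • (b - a) ≠ 0
  · have hseg : ∀ x ∈ segment ℝ a b, x ≠ 0 := by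
      intro x hx
      rw [segment_eq_image'] at hx
      obtain ⟨s, hs', rfl⟩ := hx
      exact hs s hs'
    refine ((convex_segment a b).norm_image_sub_le_of_norm_hasFDerivWithin_le
      (fun x hx => (hasFDerivAt_gradient h.smooth (hseg x hx)).hasFDerivWithinAt)
      (fun x hx => hb₁ x (hseg x hx)) (left_mem_segment ℝ a b) (right_mem_segment ℝ a b)).trans ?_
    gcongr
    exact le_max_left _ _
  · push Not at hs
    obtain ⟨s, ⟨hs0, hs1⟩, hs⟩ := hs
    have ha : a = -(s • (b - a)) := eq_neg_of_add_eq_zero_left hs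
    have hb : b = (1 - s) • (b - a) := by
      linear_combination (norm := module) hs
    have ha' : ‖a‖ = s * ‖b - a‖ := by
      nth_rw 1 [ha]
      rw [norm_neg, norm_smul, Real.norm_eq_abs, abs_of_nonneg hs0]
    have hb' : ‖b‖ = (1 - s) * ‖b - a‖ := by
      nth_rw 1 [hb]
      rw [norm_smul, Real.norm_eq_abs, abs_of_nonneg (by linarith)]
    calc ‖gradient ψ b - gradient ψ a‖ ≤ ‖gradient ψ b‖ + ‖gradient ψ a‖ := norm_sub_le _ _
      _ ≤ C₂ * ‖b‖ + C₂ * ‖a‖ := add_le_add (hb₂ b) (hb₂ a)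
      _ = C₂ * ‖b - a‖ := by rw [ha', hb']; ring
      _ ≤ _ := by gcongr; exact le_max_right _ _

/-- The midpoint convexity defect of `ψ` at `x` in the direction `e`. -/
def defect (ψ : E n → ℝ) (e : E n) (t : ℝ) (x : E n) : ℝ :=
  (ψ (x + t • e) + ψ (x - t • e)) / 2 - ψ x

lemma exists_bound_defect (h : IsQuadGauge ψ) (e : E n) :
    ∃ C, ∀ t x, |defect ψ e t x| ≤ C * t ^ 2 := by
  obtain ⟨L, hL, hb⟩ := h.exists_lipschitz_gradient
  refine ⟨L * ‖e‖ ^ 2, fun t x => ?_⟩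
  have h1 := h.add_inner_gradient_le x (x + t • e)
  have h2 := h.add_inner_gradient_le x (x - t • e)
  have h3 := h.add_inner_gradient_le (x + t • e) x
  have h4 := h.add_inner_gradient_le (x - t • e) x
  have e1 : x + t • e - x = t • e := by abel
  have e2 : x - t • e - x = -(t • e) := by abel
  have e3 : x - (x + t • e) = -(t • e) := by abel
  have e4 : x - (x - t • e) = t • e := by abel
  rw [e1] at h1
  rw [e2, inner_neg_right] at h2
  rw [e3, inner_neg_right] at h3
  rw [e4] at h4
  have h5 := real_inner_le_norm (gradient ψ (x + t • e) - gradient ψ (x - t • e)) (t • e)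
  have h6 := hb (x - t • e) (x + t • e)
  have e5 : x + t • e - (x - t • e) = (2 : ℝ) • (t • e) := by rw [two_smul]; abel
  rw [e5, norm_smul, norm_smul] at h6
  rw [inner_sub_left, norm_smul] at h5
  have h7 := mul_le_mul_of_nonneg_right h6 (by positivity : 0 ≤ ‖t‖ * ‖e‖)
  have h8 : ‖t‖ ^ 2 = t ^ 2 := by simp
  have h9 : L * (‖(2 : ℝ)‖ * (‖t‖ * ‖e‖)) * (‖t‖ * ‖e‖) = 2 * (L * ‖e‖ ^ 2 * t ^ 2) := by
    rw [← h8, Real.norm_two]; ring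
  rw [defect, abs_le]
  constructor
  · have : 0 ≤ L * ‖e‖ ^ 2 * t ^ 2 := by positivity
    linarith
  · linarith

open Filter Topology in
lemma tendsto_defect (h : IsQuadGauge ψ) (e : E n) {x : E n} (hx : x ≠ 0) :
    Tendsto (fun t => defect ψ e t x / t ^ 2) (𝓝[>] 0) (𝓝 (⟪hess ψ x e, e⟫ / 2)) := by
  set k : ℝ → ℝ := fun s => ⟪gradient ψ (x + s • e), e⟫ with hk
  have hk0 : HasDerivAt k ⟪hess ψ x e, e⟫ 0 := by
    have := h.hasDerivAt_gradient_line x e (s := 0) (by simpa using hx)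
    simp only [zero_smul, add_zero] at this
    exact this
  have hk1 : HasDerivAt (fun t => k t - k (-t)) (2 * ⟪hess ψ x e, e⟫) 0 := by
    have h1 : HasDerivAt (fun t : ℝ => k (-t)) (-⟪hess ψ x e, e⟫) 0 := by
      have := HasDerivAt.scomp (h := fun t : ℝ => -t) (0 : ℝ) (by simpa using hk0)
        (hasDerivAt_neg (0 : ℝ))
      simpa [Function.comp_def] using this
    exact (hk0.sub h1).congr_deriv (by ring)
  have hd : ∀ t, HasDerivAt (fun t => defect ψ e t x) ((k t - k (-t)) / 2) t := by
    intro t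
    have h1 := h.hasDerivAt_line x e t
    have h2 : HasDerivAt (fun t : ℝ => ψ (x - t • e)) (-k (-t)) t := by
      have := HasDerivAt.scomp (h := fun t : ℝ => -t) t (h.hasDerivAt_line x e (-t))
        (hasDerivAt_neg t)
      simpa [Function.comp_def, ← sub_eq_add_neg, hk] using this
    exact ((h1.add h2).div_const 2).sub_const (ψ x)
  refine HasDerivAt.lhopital_zero_nhdsGT (f' := fun t => (k t - k (-t)) / 2)
    (g' := fun t => 2 * t) (.of_forall hd) (.of_forall fun t => by simpa using hasDerivAt_pow 2 t)
    ?_ ?_ ?_ ?_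
  · filter_upwards [self_mem_nhdsWithin] with t ht
    have : (0 : ℝ) < t := ht
    positivity
  · have := (hd 0).continuousAt.tendsto
    have h0 : defect ψ e 0 x = 0 := by simp [defect]
    rw [h0] at this
    exact this.mono_left nhdsWithin_le_nhds
  · have := (continuous_pow 2).tendsto (0 : ℝ)
    rw [zero_pow two_ne_zero] at this
    exact this.mono_left nhdsWithin_le_nhds
  · have h1 := hk1.tendsto_slope_zero_right
    have h2 := h1.div_const 4
    have e1 : 2 * ⟪hess ψ x e, e⟫ / 4 = ⟪hess ψ x e, e⟫ / 2 := by ring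
    rw [e1] at h2
    refine h2.congr fun t => ?_
    simp [div_eq_mul_inv]
    ring

end IsQuadGauge

namespace IsQuadGauge

variable {n : ℕ} {ψ : E n → ℝ}

lemma integrable_exp_norm_sub (h : IsQuadGauge ψ) (B : ℝ) :
    Integrable fun x => Real.exp (B * ‖x‖ - ψ x) := by
  obtain ⟨c, hc, hcb⟩ := h.exists_lower_bound
  have hg : Integrable fun x : E n => Real.exp (-(c / 2) * ‖x‖ ^ 2) := by
    have := (GaussianFourier.integrable_cexp_neg_mul_sq_norm_add (b := ((c / 2 : ℝ) : ℂ))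
      (by simpa using hc) 0 (0 : E n)).norm
    refine this.congr (.of_forall fun x => ?_)
    simp only [Complex.norm_exp, zero_mul, add_zero]
    norm_cast
  have hcont := h.continuous
  refine (hg.const_mul (Real.exp (B ^ 2 / (2 * c)))).mono'
    (Continuous.aestronglyMeasurable (by fun_prop)) (.of_forall fun x => ?_)
  rw [Real.norm_eq_abs, Real.abs_exp, ← Real.exp_add, Real.exp_le_exp]
  have h1 := hcb x
  have h2 : B ^ 2 / (2 * c) - B * ‖x‖ + c / 2 * ‖x‖ ^ 2 = (B - c * ‖x‖) ^ 2 / (2 * c) := by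
    field_simp
    ring
  have h3 : 0 ≤ (B - c * ‖x‖) ^ 2 / (2 * c) := by positivity
  linarith

lemma integrable_of_norm_le (h : IsQuadGauge ψ) {F : Type*} [NormedAddCommGroup F] {f : E n → F}
    (hf : AEStronglyMeasurable f) (A B : ℝ)
    (hb : ∀ x, x ≠ 0 → ‖f x‖ ≤ A * Real.exp (B * ‖x‖ - ψ x)) : Integrable f := by
  refine ((h.integrable_exp_norm_sub B).const_mul A).mono' hf ?_
  filter_upwards [compl_mem_ae_iff.2 (measure_singleton (0 : E n))] with x hx
  exact hb x hx

/-- The change of variables `y = ∇ψ(x)`. -/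
lemma lintegral_gradient (h : IsQuadGauge ψ) (f : E n → ℝ≥0∞) :
    ∫⁻ x, ENNReal.ofReal |(hess ψ x).det| * f (gradient ψ x) = ∫⁻ y, f y := by
  have h1 := lintegral_image_eq_lintegral_abs_det_fderiv_mul volume
    (measurableSet_singleton (0 : E n)).compl
    (fun x hx => (hasFDerivAt_gradient h.smooth hx).hasFDerivWithinAt)
    h.gradient_injective.injOn f
  have himg : gradient ψ '' {0}ᶜ = {0}ᶜ := by
    rw [Set.image_compl_eq ⟨h.gradient_injective, h.gradient_surjective⟩, Set.image_singleton,
      h.gradient_zero]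
  rw [himg, restrict_compl_singleton] at h1
  exact h1.symm

/-- The density `e^{-ψ} |det D²ψ|`. -/
def weight (ψ : E n → ℝ) (x : E n) : ℝ := Real.exp (-ψ x) * |(hess ψ x).det|

lemma weight_nonneg (ψ : E n → ℝ) (x : E n) : 0 ≤ weight ψ x := by
  unfold weight; positivity

lemma measurable_det_hess (ψ : E n → ℝ) : Measurable fun x => (hess ψ x).det :=
  ContinuousLinearMap.continuous_det.measurable.comp (measurable_fderiv ℝ (gradient ψ))

lemma measurable_weight (h : IsQuadGauge ψ) : Measurable (weight ψ) :=
  (h.continuous.neg.rexp.measurable).mul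
    (measurable_det_hess ψ).norm

lemma exists_bound_det (h : IsQuadGauge ψ) : ∃ C, 0 ≤ C ∧ ∀ x, x ≠ 0 → |(hess ψ x).det| ≤ C :=
  exists_bound_of_homogeneous
    (ContinuousLinearMap.continuous_det.comp_continuousOn (continuousOn_hess h.smooth))
    fun t x ht _ => by simp only [Function.comp_apply, h.hess_smul ht]

lemma integrable_weight_smul (h : IsQuadGauge ψ) {F : Type*} [NormedAddCommGroup F]
    [NormedSpace ℝ F] {f : E n → F} (hf : AEStronglyMeasurable f) (A B : ℝ)
    (hb : ∀ x, x ≠ 0 → ‖f x‖ ≤ A * Real.exp (B * ‖x‖)) : Integrable fun x => weight ψ x • f x := by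
  obtain ⟨C, hC, hCb⟩ := h.exists_bound_det
  refine h.integrable_of_norm_le (h.measurable_weight.aestronglyMeasurable.smul hf) (C * A) B
    fun x hx => ?_
  have h1 := mul_le_mul (hCb x hx) (hb x hx) (norm_nonneg _) hC
  rw [norm_smul, weight, Real.norm_eq_abs, abs_mul, abs_abs, Real.abs_exp, mul_assoc,
    sub_eq_neg_add, Real.exp_add]
  calc _ ≤ Real.exp (-ψ x) * (C * (A * Real.exp (B * ‖x‖))) := by gcongr
    _ = _ := by ring

/-- The measure with density `e^{-ψ} |det D²ψ|`. -/
def gaugeMeasure (ψ : E n → ℝ) : Measure (E n) :=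
  volume.withDensity fun x => ENNReal.ofReal (weight ψ x)

lemma integral_gaugeMeasure (h : IsQuadGauge ψ) {F : Type*} [NormedAddCommGroup F]
    [NormedSpace ℝ F] (f : E n → F) : ∫ x, f x ∂gaugeMeasure ψ = ∫ x, weight ψ x • f x := by
  rw [gaugeMeasure, integral_withDensity_eq_integral_toReal_smul
    h.measurable_weight.ennreal_ofReal (by simp)]
  simp_rw [ENNReal.toReal_ofReal (weight_nonneg ψ _)]

lemma integrable_gaugeMeasure (h : IsQuadGauge ψ) {F : Type*} [NormedAddCommGroup F]
    [NormedSpace ℝ F] {f : E n → F} :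
    Integrable f (gaugeMeasure ψ) ↔ Integrable fun x => weight ψ x • f x := by
  rw [gaugeMeasure, integrable_withDensity_iff_integrable_smul'
    h.measurable_weight.ennreal_ofReal (by simp)]
  simp_rw [ENNReal.toReal_ofReal (weight_nonneg ψ _)]

lemma ofReal_integral_exp (h : IsQuadGauge ψ) {k : E n → ℝ} (hk : Continuous k) (A B : ℝ)
    (hb : ∀ x, k x ≤ A + B * ‖x‖) :
    ENNReal.ofReal (∫ x, Real.exp (k x) ∂gaugeMeasure ψ) =
      ∫⁻ y, Function.extend (gradient ψ) (fun x => ENNReal.ofReal (Real.exp (k x - ψ x))) 0 y := by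
  have hi : Integrable fun x => weight ψ x • Real.exp (k x) := by
    refine h.integrable_weight_smul hk.rexp.aestronglyMeasurable (Real.exp A) B fun x _ => ?_
    rw [Real.norm_eq_abs, Real.abs_exp, ← Real.exp_add]
    exact Real.exp_le_exp.2 (hb x)
  rw [h.integral_gaugeMeasure, ofReal_integral_eq_lintegral_ofReal hi
    (.of_forall fun x => smul_nonneg (weight_nonneg ψ x) (Real.exp_pos _).le),
    ← h.lintegral_gradient (Function.extend _ _ _)]
  refine lintegral_congr fun x => ?_
  rw [h.gradient_injective.extend_apply, ← ENNReal.ofReal_mul (abs_nonneg _), weight, smul_eq_mul,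
    sub_eq_add_neg, Real.exp_add]
  congr 1
  ring

lemma measurable_extend (h : IsQuadGauge ψ) {k : E n → ℝ} (hk : Continuous k) :
    Measurable (Function.extend (gradient ψ)
      (fun x => ENNReal.ofReal (Real.exp (k x - ψ x))) 0) := by
  refine (h.continuous_gradient.measurableEmbedding h.gradient_injective).measurable_extend ?_
    measurable_const
  have := h.continuous
  exact (by fun_prop : Continuous fun x => Real.exp (k x - ψ x)).measurable.ennreal_ofReal

lemma continuous_defect (h : IsQuadGauge ψ) (e : E n) (t : ℝ) : Continuous (defect ψ e t) := by
  have := h.continuous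
  unfold defect
  fun_prop

/-- The exponential moment inequality obtained from the Prékopa–Leindler inequality. -/
lemma integral_exp_mul_integral_exp_le (h : IsQuadGauge ψ) (e : E n) (t : ℝ) :
    (∫ x, Real.exp (t * ⟪gradient ψ x, e⟫) ∂gaugeMeasure ψ) *
      (∫ x, Real.exp (-t * ⟪gradient ψ x, e⟫) ∂gaugeMeasure ψ) ≤
      (∫ x, Real.exp (defect ψ e t x) ∂gaugeMeasure ψ) ^ 2 := by
  have hP := h.continuous_gradient
  obtain ⟨C, hC, hCb⟩ := h.exists_bound_gradient
  obtain ⟨D, hD⟩ := h.exists_bound_defect e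
  have hb : ∀ s : ℝ, ∀ x, s * ⟪gradient ψ x, e⟫ ≤ 0 + (|s| * C * ‖e‖) * ‖x‖ := by
    intro s x
    calc s * ⟪gradient ψ x, e⟫ ≤ |s| * (C * ‖x‖ * ‖e‖) := by
          refine (le_abs_self _).trans ?_
          rw [abs_mul]
          gcongr
          exact (abs_real_inner_le_norm _ _).trans (by gcongr; exact hCb x)
      _ = _ := by ring
  have hk : ∀ s : ℝ, Continuous fun x => s * ⟪gradient ψ x, e⟫ := fun s => by fun_prop
  have h1 := h.ofReal_integral_exp (hk t) _ _ (hb t)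
  have h2 := h.ofReal_integral_exp (hk (-t)) _ _ (hb (-t))
  have h3 := h.ofReal_integral_exp (h.continuous_defect e t) (D * t ^ 2) 0
    (fun x => by simpa using (le_abs_self _).trans (hD t x))
  have hPL := midpointPrekopaLeindler_euclidean (n + 1) _ _ _ (h.measurable_extend (hk t))
    (h.measurable_extend (hk (-t))) (h.measurable_extend (h.continuous_defect e t)) ?_
  · rw [← h1, ← h2, ← h3, ← ENNReal.ofReal_mul (integral_nonneg fun _ => (Real.exp_pos _).le),
      ← ENNReal.ofReal_pow (integral_nonneg fun _ => (Real.exp_pos _).le)] at hPL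
    exact (ENNReal.ofReal_le_ofReal_iff (sq_nonneg _)).1 hPL
  · intro y z
    obtain ⟨a, rfl⟩ := h.gradient_surjective y
    obtain ⟨b, rfl⟩ := h.gradient_surjective z
    obtain ⟨c, hc⟩ := h.gradient_surjective ((1 / 2 : ℝ) • (gradient ψ a + gradient ψ b))
    rw [← hc, h.gradient_injective.extend_apply, h.gradient_injective.extend_apply,
      h.gradient_injective.extend_apply, ← ENNReal.ofReal_mul (Real.exp_pos _).le,
      ← ENNReal.ofReal_pow (Real.exp_pos _).le, ← Real.exp_add, ← Real.exp_nat_mul]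
    refine ENNReal.ofReal_le_ofReal (Real.exp_le_exp.2 ?_)
    have e1 := h.inner_gradient_le a (c + t • e)
    have e2 := h.inner_gradient_le b (c - t • e)
    have e3 := h.inner_gradient_self c
    rw [inner_add_right, real_inner_smul_right] at e1
    rw [inner_sub_right, real_inner_smul_right] at e2
    rw [hc, real_inner_smul_left, inner_add_left] at e3
    rw [defect]
    push_cast
    linarith

/-- A Brascamp–Lieb type inequality for the measure with density `e^{-ψ} |det D²ψ|`. -/
lemma integral_inner_gradient_sq_le (h : IsQuadGauge ψ) (e : E n)
    (h0 : ∫ x, weight ψ x • ⟪gradient ψ x, e⟫ = 0) :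
    ∫ x, weight ψ x • ⟪gradient ψ x, e⟫ ^ 2 ≤ ∫ x, weight ψ x • ⟪hess ψ x e, e⟫ := by
  have hP := h.continuous_gradient
  obtain ⟨C, hC, hCb⟩ := h.exists_bound_gradient
  obtain ⟨D, hD⟩ := h.exists_bound_defect e
  have hfin : IsFiniteMeasure (gaugeMeasure ψ) := by
    refine isFiniteMeasure_withDensity_ofReal (Integrable.hasFiniteIntegral ?_)
    have := h.integrable_weight_smul (f := fun _ => (1 : ℝ)) aestronglyMeasurable_const 1 0
      (by simp)
    simpa using this
  have := integral_sq_le_of_exp_moments (ν := gaugeMeasure ψ) (p := fun x => ⟪gradient ψ x, e⟫)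
    (q := fun x => ⟪hess ψ x e, e⟫) (δ := defect ψ e) (C := D)
    (Continuous.aestronglyMeasurable (by fun_prop)) ?_ ?_
    (fun t => (h.continuous_defect e t).aestronglyMeasurable) hD ?_
    (fun t _ _ => h.integral_exp_mul_integral_exp_le e t)
  · rwa [h.integral_gaugeMeasure, h.integral_gaugeMeasure] at this
  · rw [h.integrable_gaugeMeasure]
    refine h.integrable_weight_smul (Continuous.aestronglyMeasurable (by fun_prop)) 1
      (4 * (C * ‖e‖)) fun x _ => ?_
    rw [Real.norm_eq_abs, Real.abs_exp, one_mul, Real.exp_le_exp]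
    calc 4 * |⟪gradient ψ x, e⟫| ≤ 4 * (C * ‖x‖ * ‖e‖) := by
          gcongr
          exact (abs_real_inner_le_norm _ _).trans (by gcongr; exact hCb x)
      _ = _ := by ring
  · rw [h.integral_gaugeMeasure, h0]
  · have hac : gaugeMeasure ψ ≪ volume := withDensity_absolutelyContinuous _ _
    refine hac.ae_le ?_
    filter_upwards [compl_mem_ae_iff.2 (measure_singleton (0 : E n))] with x hx
    exact h.tendsto_defect e hx

end IsQuadGauge

namespace IsQuadGauge

variable {n : ℕ} {ψ : E n → ℝ}

lemma integral_gradient (h : IsQuadGauge ψ) {F : Type*} [NormedAddCommGroup F] [NormedSpace ℝ F]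
    (f : E n → F) : ∫ x, |(hess ψ x).det| • f (gradient ψ x) = ∫ y, f y := by
  have h1 := integral_image_eq_integral_abs_det_fderiv_smul volume
    (measurableSet_singleton (0 : E n)).compl
    (fun x hx => (hasFDerivAt_gradient h.smooth hx).hasFDerivWithinAt)
    h.gradient_injective.injOn f
  have himg : gradient ψ '' {0}ᶜ = {0}ᶜ := by
    rw [Set.image_compl_eq ⟨h.gradient_injective, h.gradient_surjective⟩, Set.image_singleton,
      h.gradient_zero]
  rw [himg, restrict_compl_singleton] at h1
  exact h1.symm

lemma setIntegral_sublevel_eq_zero (h : IsQuadGauge ψ) {F : Type*} [NormedAddCommGroup F]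
    [NormedSpace ℝ F] {g : E n → F} (hg : ∀ (s : ℝ) (x : E n), 0 < s → g (s • x) = s • g x)
    (h0 : ∫ x, {x | ψ x ≤ 1 / 2}.indicator g x = 0) (r : ℝ) :
    ∫ x, {x | ψ x ≤ r}.indicator g x = 0 := by
  rcases le_or_gt r 0 with hr | hr
  · have hg0 : g 0 = 0 := by
      have := hg 2 0 (by norm_num)
      rw [smul_zero, two_smul] at this
      simpa using this
    refine (integral_congr_ae (.of_forall fun x => ?_)).trans (integral_zero _ _)
    simp only [Set.indicator_apply_eq_zero, Set.mem_ofPred_eq]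
    intro hx
    by_cases hx0 : x = 0
    · rw [hx0, hg0]
    · linarith [h.pos hx0]
  · set s := √(2 * r) with hs
    have hs0 : 0 < s := by positivity
    have hs2 : s ^ 2 = 2 * r := Real.sq_sqrt (by positivity)
    have h1 := Measure.integral_comp_smul (volume : Measure (E n)) ({x | ψ x ≤ r}.indicator g) s
    have h2 : ∀ x, {x | ψ x ≤ r}.indicator g (s • x) = s • {x | ψ x ≤ 1 / 2}.indicator g x := by
      intro x
      rw [← Set.indicator_const_smul_apply]
      have : ψ (s • x) ≤ r ↔ ψ x ≤ 1 / 2 := by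
        rw [h.hom s x hs0, hs2]
        constructor <;> intro <;> nlinarith
      by_cases hx : ψ x ≤ 1 / 2
      · rw [Set.indicator_of_mem (by simpa using this.2 hx), Set.indicator_of_mem (by simpa using hx),
          hg s x hs0]
      · rw [Set.indicator_of_notMem (by simpa using fun h => hx (this.1 h)),
          Set.indicator_of_notMem (by simpa using hx)]
    simp_rw [h2] at h1
    rw [integral_smul, h0, smul_zero] at h1
    exact (smul_eq_zero.1 h1.symm).resolve_left (by positivity)

lemma integral_exp_neg_smul_eq_zero (h : IsQuadGauge ψ) {F : Type*} [NormedAddCommGroup F]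
    [NormedSpace ℝ F] [CompleteSpace F] {g : E n → F} (hgm : StronglyMeasurable g)
    (hg : ∀ (s : ℝ) (x : E n), 0 < s → g (s • x) = s • g x)
    (hinteg : Integrable fun x => Real.exp (-ψ x) • g x)
    (h0 : ∫ x, {x | ψ x ≤ 1 / 2}.indicator g x = 0) :
    ∫ x, Real.exp (-ψ x) • g x = 0 := by
  set f : E n → ℝ → F := fun x r => (Set.Ici (ψ x)).indicator (fun r => Real.exp (-r)) r • g x
    with hf
  have hI : ∀ c : ℝ, ∫ r, (Set.Ici c).indicator (fun r => Real.exp (-r)) r = Real.exp (-c) := by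
    intro c
    rw [integral_indicator measurableSet_Ici, integral_Ici_eq_integral_Ioi, integral_exp_neg_Ioi]
  have hI' : ∀ c : ℝ, Integrable ((Set.Ici c).indicator (fun r => Real.exp (-r))) := by
    intro c
    rw [integrable_indicator_iff measurableSet_Ici, integrableOn_Ici_iff_integrableOn_Ioi]
    exact integrableOn_exp_neg_Ioi c
  have hm : AEStronglyMeasurable (Function.uncurry f) (volume.prod volume) := by
    have hcl : MeasurableSet {p : E n × ℝ | ψ p.1 ≤ p.2} :=
      (isClosed_le (h.continuous.comp continuous_fst) continuous_snd).measurableSet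
    have h1 : StronglyMeasurable ({p : E n × ℝ | ψ p.1 ≤ p.2}.indicator
        fun p => Real.exp (-p.2)) :=
      (by fun_prop : Continuous fun p : E n × ℝ => Real.exp (-p.2)).stronglyMeasurable.indicator hcl
    exact (h1.smul (hgm.comp_measurable measurable_fst)).aestronglyMeasurable
  have hi : Integrable (Function.uncurry f) (volume.prod volume) := by
    rw [integrable_prod_iff hm]
    refine ⟨.of_forall fun x => (hI' (ψ x)).smul_const (g x), hinteg.norm.congr (.of_forall fun x => ?_)⟩
    simp only [Function.uncurry, hf, norm_smul]
    rw [integral_mul_const]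
    congr 1
    rw [Real.norm_eq_abs, Real.abs_exp, ← hI]
    refine integral_congr_ae (.of_forall fun r => ?_)
    exact (Real.norm_of_nonneg (Set.indicator_nonneg (fun _ _ => (Real.exp_pos _).le) r)).symm
  have hswap := integral_integral_swap hi
  have h1 : ∀ x, ∫ r, f x r = Real.exp (-ψ x) • g x := fun x => by
    rw [hf, integral_smul_const, hI]
  have h2 : ∀ r, ∫ x, f x r = 0 := fun r => by
    have : ∀ x, f x r = Real.exp (-r) • {x | ψ x ≤ r}.indicator g x := by
      intro x
      by_cases hx : ψ x ≤ r
      · simp [hf, hx]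
      · simp [hf, hx]
    simp_rw [this]
    rw [integral_smul, h.setIntegral_sublevel_eq_zero hg h0, smul_zero]
  simp_rw [h1, h2] at hswap
  rw [hswap, integral_zero]

end IsQuadGauge

lemma body_eq_image {n : ℕ} {H : E n → ℝ} (h : IsQuadGauge fun x => H x ^ 2 / 2)
    (hhom : ∀ (t : ℝ) (x : E n), 0 < t → H (t • x) = t * H x)
    (hpos : ∀ x ∈ sphere (0 : E n) 1, 0 < H x) :
    body H = gradient (fun x => H x ^ 2 / 2) '' {x | H x ^ 2 / 2 ≤ 1 / 2} := by
  ext y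
  obtain ⟨x, rfl⟩ := h.gradient_surjective y
  rw [h.gradient_injective.mem_set_image, Set.mem_ofPred_eq]
  constructor
  · intro hx
    by_cases hx0 : x = 0
    · have := h.map_zero
      simp only [hx0] at this ⊢
      linarith
    have hx0' : 0 < ‖x‖ := norm_pos_iff.2 hx0
    have hu : ‖x‖⁻¹ • x ∈ sphere (0 : E n) 1 := by simp [norm_smul, hx0'.ne']
    have h1 := hx _ hu
    have h2 := hpos _ hu
    rw [hhom _ _ (inv_pos.2 hx0')] at h1 h2
    rw [real_inner_smul_right, h.inner_gradient_self] at h1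
    have h3 := le_of_mul_le_mul_left h1 (inv_pos.2 hx0')
    have h4 : 0 < H x := pos_of_mul_pos_right h2 (inv_pos.2 hx0').le
    nlinarith
  · intro hx u hu
    have h1 := hpos u hu
    have h2 := h.inner_gradient_le x ((H u)⁻¹ • u)
    rw [real_inner_smul_right, hhom _ _ (inv_pos.2 h1), inv_mul_cancel₀ h1.ne',
      inv_mul_le_iff₀ h1] at h2
    nlinarith

lemma integral_weight_smul_gradient_eq_zero {n : ℕ} {H : E n → ℝ}
    (h : IsQuadGauge fun x => H x ^ 2 / 2)
    (hhom : ∀ (t : ℝ) (x : E n), 0 < t → H (t • x) = t * H x)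
    (hpos : ∀ x ∈ sphere (0 : E n) 1, 0 < H x) (hcentroid : ∫ y in body H, y = 0) :
    ∫ x, IsQuadGauge.weight (fun x => H x ^ 2 / 2) x • gradient (fun x => H x ^ 2 / 2) x = 0 := by
  set ψ : E n → ℝ := fun x => H x ^ 2 / 2 with hψ
  have hP := h.continuous_gradient
  have hb := body_eq_image h hhom hpos
  have hbm : MeasurableSet (body H) := by
    have : body H = ⋂ x ∈ sphere (0 : E n) 1, {y | ⟪y, x⟫ ≤ H x} := by
      ext y; simp [body]
    rw [this]
    exact (isClosed_biInter fun x _ => isClosed_le (by fun_prop) continuous_const).measurableSet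
  rw [← integral_indicator hbm, ← h.integral_gradient] at hcentroid
  simp_rw [IsQuadGauge.weight, mul_smul]
  obtain ⟨C, hC, hCb⟩ := h.exists_bound_gradient
  refine h.integral_exp_neg_smul_eq_zero
    ((IsQuadGauge.measurable_det_hess ψ).norm.stronglyMeasurable.smul hP.stronglyMeasurable)
    (fun s x hs => ?_) ?_ ?_
  · rw [h.hess_smul hs, h.gradient_smul hs, smul_comm]
  · have := h.integrable_weight_smul hP.aestronglyMeasurable C 1 fun x _ => (hCb x).trans (by
      gcongr
      rw [one_mul]
      linarith [Real.add_one_le_exp ‖x‖])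
    simpa only [IsQuadGauge.weight, mul_smul] using this
  · rw [← hcentroid]
    refine integral_congr_ae (.of_forall fun x => ?_)
    beta_reduce
    by_cases hx : ψ x ≤ 1 / 2
    · have : gradient ψ x ∈ body H := by
        rw [hb]; exact ⟨x, hx, rfl⟩
      rw [Set.indicator_of_mem (by exact hx), Set.indicator_of_mem this]
    · have : gradient ψ x ∉ body H := by
        rw [hb, h.gradient_injective.mem_set_image]; exact hx
      rw [Set.indicator_of_notMem (by exact hx), Set.indicator_of_notMem this, smul_zero]

lemma aestronglyMeasurable_of_continuousOn_compl {n : ℕ} {F : Type*} [NormedAddCommGroup F]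
    {f : E n → F} (hf : ContinuousOn f {0}ᶜ) : AEStronglyMeasurable f := by
  have := hf.aestronglyMeasurable_of_isSeparable (μ := volume) (measurableSet_singleton (0 : E n)).compl
    (TopologicalSpace.IsSeparable.of_separableSpace _)
  rwa [restrict_compl_singleton] at this

lemma hasDerivAt_cutoff {ε s : ℝ} (hε : 0 < ε) (hs : 0 ≤ s) :
    HasDerivAt (fun s => Real.exp (-s) * (s / (s + ε)))
      (Real.exp (-s) * (ε / (s + ε) ^ 2 - s / (s + ε))) s := by
  have h1 : HasDerivAt (fun s : ℝ => Real.exp (-s)) (-Real.exp (-s)) s := by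
    simpa using (hasDerivAt_neg s).exp
  have hne : s + ε ≠ 0 := by positivity
  have h2 : HasDerivAt (fun s : ℝ => s / (s + ε)) (ε / (s + ε) ^ 2) s := by
    have := (hasDerivAt_id s).div ((hasDerivAt_id s).add_const ε) hne
    exact this.congr_deriv (by simp)
  exact (h1.mul h2).congr_deriv (by ring)

lemma fderiv_smul_of_homogeneous {n : ℕ} {Φ : E n → ℝ}
    (hhom : ∀ (t : ℝ) (x : E n), 0 < t → Φ (t • x) = Φ x) {t : ℝ} (ht : 0 < t) (x : E n) :
    fderiv ℝ Φ (t • x) = t⁻¹ • fderiv ℝ Φ x := by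
  have e : (fun y => Φ (t • y)) = Φ := funext fun y => hhom t y ht
  have h1 : fderiv ℝ (fun y => Φ (t • y)) x = t • fderiv ℝ Φ (t • x) := fderiv_comp_smul t
  rw [e] at h1
  rw [h1, smul_smul, inv_mul_cancel₀ ht.ne', one_smul]

namespace IsQuadGauge

variable {n : ℕ} {ψ Φ : E n → ℝ}

/-- The integrand arising from integrating by parts in the direction `e`. -/
def divTerm (ψ Φ : E n → ℝ) (e x : E n) : ℝ :=
  Φ x * (⟪hess ψ x e, e⟫ - ⟪gradient ψ x, e⟫ ^ 2) + fderiv ℝ Φ x e * ⟪gradient ψ x, e⟫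

lemma exists_bound_fderiv_mul (h : IsQuadGauge ψ) (hΦ : ContDiffOn ℝ 1 Φ {0}ᶜ)
    (hhom : ∀ (t : ℝ) (x : E n), 0 < t → Φ (t • x) = Φ x) (e : E n) :
    ∃ C, 0 ≤ C ∧ ∀ x, x ≠ 0 → |fderiv ℝ Φ x e * ⟪gradient ψ x, e⟫| ≤ C := by
  have hP := h.continuous_gradient
  have hD := hΦ.continuousOn_fderiv_of_isOpen isOpen_compl_singleton le_rfl
  refine exists_bound_of_homogeneous (f := fun x => fderiv ℝ Φ x e * ⟪gradient ψ x, e⟫)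
    (by fun_prop) fun t x ht hx => ?_
  rw [fderiv_smul_of_homogeneous hhom ht, h.gradient_smul ht, real_inner_smul_left,
    smul_apply, smul_eq_mul]
  field_simp

lemma continuousOn_divTerm (h : IsQuadGauge ψ) (hΦ : ContDiffOn ℝ 1 Φ {0}ᶜ) (e : E n) :
    ContinuousOn (divTerm ψ Φ e) {0}ᶜ := by
  have hP := h.continuous_gradient
  have hD := hΦ.continuousOn_fderiv_of_isOpen isOpen_compl_singleton le_rfl
  have hA := continuousOn_hess h.smooth
  have hΦc := hΦ.continuousOn
  unfold divTerm
  fun_prop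

lemma inner_gradient_sq_le (h : IsQuadGauge ψ) (e : E n) :
    ∃ C, 0 ≤ C ∧ ∀ x, ⟪gradient ψ x, e⟫ ^ 2 ≤ C * Real.exp (2 * ‖x‖) := by
  obtain ⟨C, hC, hCb⟩ := h.exists_bound_gradient
  refine ⟨(C * ‖e‖) ^ 2, by positivity, fun x => ?_⟩
  have h1 : |⟪gradient ψ x, e⟫| ≤ C * ‖e‖ * Real.exp ‖x‖ := by
    calc _ ≤ ‖gradient ψ x‖ * ‖e‖ := abs_real_inner_le_norm _ _
      _ ≤ C * ‖x‖ * ‖e‖ := by gcongr; exact hCb x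
      _ = C * ‖e‖ * ‖x‖ := by ring
      _ ≤ _ := by gcongr; linarith [Real.add_one_le_exp ‖x‖]
  rw [← sq_abs, two_mul, Real.exp_add, ← sq, ← mul_pow]
  gcongr

lemma exists_bound_divTerm (h : IsQuadGauge ψ) (hΦ : ContDiffOn ℝ 1 Φ {0}ᶜ)
    (hhom : ∀ (t : ℝ) (x : E n), 0 < t → Φ (t • x) = Φ x) (e : E n) :
    ∃ A, ∀ x, x ≠ 0 → |divTerm ψ Φ e x| ≤ A * Real.exp (2 * ‖x‖) := by
  obtain ⟨C₁, hC₁, h₁⟩ := exists_bound_of_homogeneous hΦ.continuousOn fun t x ht _ => hhom t x ht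
  obtain ⟨C₂, hC₂, h₂⟩ := h.exists_bound_hess
  obtain ⟨C₃, hC₃, h₃⟩ := h.inner_gradient_sq_le e
  obtain ⟨C₄, hC₄, h₄⟩ := h.exists_bound_fderiv_mul hΦ hhom e
  refine ⟨C₁ * (C₂ * ‖e‖ * ‖e‖ + C₃) + C₄, fun x hx => ?_⟩
  have h5 : (1 : ℝ) ≤ Real.exp (2 * ‖x‖) := Real.one_le_exp (by positivity)
  have h6 : |⟪hess ψ x e, e⟫| ≤ C₂ * ‖e‖ * ‖e‖ := by
    refine (abs_real_inner_le_norm _ _).trans ?_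
    gcongr
    exact (hess ψ x).le_of_opNorm_le (h₂ x hx) e
  have h7 : |⟪hess ψ x e, e⟫ - ⟪gradient ψ x, e⟫ ^ 2| ≤
      (C₂ * ‖e‖ * ‖e‖ + C₃) * Real.exp (2 * ‖x‖) := by
    refine (abs_sub _ _).trans ?_
    rw [abs_of_nonneg (sq_nonneg ⟪gradient ψ x, e⟫), add_mul]
    refine add_le_add (h6.trans ?_) (h₃ x)
    exact le_mul_of_one_le_right (by positivity) h5
  rw [divTerm]
  refine (abs_add_le _ _).trans ?_
  rw [add_mul, abs_mul (Φ x), mul_assoc C₁]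
  refine add_le_add (mul_le_mul (h₁ x hx) h7 (abs_nonneg _) hC₁) ((h₄ x hx).trans ?_)
  exact le_mul_of_one_le_right hC₄ h5

lemma integrable_exp_neg_mul_divTerm (h : IsQuadGauge ψ) (hΦ : ContDiffOn ℝ 1 Φ {0}ᶜ)
    (hhom : ∀ (t : ℝ) (x : E n), 0 < t → Φ (t • x) = Φ x) (e : E n) :
    Integrable fun x => Real.exp (-ψ x) * divTerm ψ Φ e x := by
  obtain ⟨A, hA⟩ := h.exists_bound_divTerm hΦ hhom e
  have hc := h.continuous
  have hd := h.continuousOn_divTerm hΦ e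
  refine h.integrable_of_norm_le (aestronglyMeasurable_of_continuousOn_compl (by fun_prop)) A 2
    fun x hx => ?_
  rw [norm_mul, Real.norm_eq_abs, Real.abs_exp, sub_eq_neg_add, Real.exp_add, mul_left_comm]
  gcongr
  exact hA x hx

lemma integral_cutoff_mul_divTerm_nonpos (h : IsQuadGauge ψ) (hΦ : ContDiffOn ℝ 1 Φ {0}ᶜ)
    (hhom : ∀ (t : ℝ) (x : E n), 0 < t → Φ (t • x) = Φ x) (hΦ0 : ∀ x, x ≠ 0 → 0 ≤ Φ x) (e : E n)
    {ε : ℝ} (hε : 0 < ε) :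
    ∫ x, Real.exp (-ψ x) * (ψ x / (ψ x + ε)) * divTerm ψ Φ e x ≤ 0 := by
  have hP := h.continuous_gradient
  have hc := h.continuous
  have hΦc := hΦ.continuousOn
  have hne : ∀ x, ψ x + ε ≠ 0 := fun x => by have := h.nonneg x; positivity
  have hcut : Continuous fun x => Real.exp (-ψ x) * (ψ x / (ψ x + ε)) := by fun_prop (disch := assumption)
  have hcut_le : ∀ x, ψ x / (ψ x + ε) ≤ 1 := fun x => by
    have := h.nonneg x
    rw [div_le_one (by positivity)]
    linarith
  have hcut_nonneg : ∀ x, 0 ≤ ψ x / (ψ x + ε) := fun x => by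
    have := h.nonneg x
    positivity
  obtain ⟨C₁, hC₁, h₁⟩ := exists_bound_of_homogeneous hΦ.continuousOn fun t x ht _ => hhom t x ht
  obtain ⟨C₂, hC₂, h₂⟩ := h.exists_bound_gradient
  obtain ⟨C₃, hC₃, h₃⟩ := h.inner_gradient_sq_le e
  obtain ⟨C₄, hC₄, h₄⟩ := h.le_bound
  set F : E n → ℝ := fun x => Real.exp (-ψ x) * (ψ x / (ψ x + ε)) * (Φ x * ⟪gradient ψ x, e⟫)
    with hF
  set G : E n → ℝ := fun x => Real.exp (-ψ x) * (ε / (ψ x + ε) ^ 2) * (Φ x * ⟪gradient ψ x, e⟫ ^ 2)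
    with hG
  have hFb : ∀ x, x ≠ 0 → |Φ x * ⟪gradient ψ x, e⟫| ≤ C₁ * (C₂ * ‖e‖) * ‖x‖ := fun x hx => by
    rw [abs_mul]
    calc _ ≤ C₁ * (C₂ * ‖x‖ * ‖e‖) := by
          gcongr
          · exact h₁ x hx
          · exact (abs_real_inner_le_norm _ _).trans (by gcongr; exact h₂ x)
      _ = _ := by ring
  have hF0 : F 0 = 0 := by simp [hF, h.map_zero]
  have hderiv0 : HasFDerivAt F (0 : E n →L[ℝ] ℝ) 0 := by
    refine .of_isLittleO ?_
    refine Asymptotics.IsBigO.trans_isLittleO (g := fun x : E n => ‖x‖ ^ 3) ?_ ?_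
    · refine Asymptotics.IsBigO.of_bound (C₄ / ε * (C₁ * (C₂ * ‖e‖))) (.of_forall fun x => ?_)
      rw [hF0]
      simp only [zero_apply, sub_zero]
      rcases eq_or_ne x 0 with rfl | hx
      · simp [hF0]
      have e1 : ψ x / (ψ x + ε) ≤ C₄ / ε * ‖x‖ ^ 2 := by
        have := h.nonneg x
        rw [div_mul_eq_mul_div]
        exact div_le_div₀ (by positivity) (h₄ x) hε (by linarith)
      have e2 : Real.exp (-ψ x) ≤ 1 := Real.exp_le_one_iff.2 (neg_nonpos.2 (h.nonneg x))
      rw [hF, Real.norm_eq_abs, abs_mul, abs_mul, Real.abs_exp, abs_of_nonneg (hcut_nonneg x),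
        Real.norm_of_nonneg (by positivity)]
      calc _ ≤ 1 * (C₄ / ε * ‖x‖ ^ 2) * (C₁ * (C₂ * ‖e‖) * ‖x‖) :=
            mul_le_mul (mul_le_mul e2 e1 (hcut_nonneg x) zero_le_one) (hFb x hx) (abs_nonneg _)
              (by positivity)
        _ = _ := by ring
    · simpa using Asymptotics.isLittleO_norm_pow_id (E' := E n) (by norm_num : 1 < 3)
  have hderiv : ∀ x, x ≠ 0 → DifferentiableAt ℝ F x ∧ fderiv ℝ F x e =
      Real.exp (-ψ x) * (ψ x / (ψ x + ε)) * divTerm ψ Φ e x + G x := by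
    intro x hx
    have d1 := (hasDerivAt_cutoff hε (h.nonneg x)).comp_hasFDerivAt x
      (h.hasGradientAt hx).hasFDerivAt
    have d2 : HasFDerivAt Φ (fderiv ℝ Φ x) x :=
      ((hΦ.contDiffAt (isOpen_compl_singleton.mem_nhds hx)).differentiableAt (by simp)).hasFDerivAt
    have d3 := (hasFDerivAt_gradient h.smooth hx).inner ℝ (hasFDerivAt_const e x)
    have d4 := d1.mul (d2.mul d3)
    refine ⟨d4.differentiableAt, ?_⟩
    have d5 : HasFDerivAt F _ x := d4
    rw [d5.fderiv]
    simp only [add_apply, smul_apply, smul_eq_mul,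
      ContinuousLinearMap.comp_apply, ContinuousLinearMap.prod_apply, fderivInnerCLM_apply,
      zero_apply, inner_zero_right, zero_add, Function.comp_apply, Pi.mul_apply,
      InnerProductSpace.toDual_apply_apply, hG, divTerm]
    ring
  have hdiff : Differentiable ℝ F := fun x => by
    rcases eq_or_ne x 0 with rfl | hx
    · exact hderiv0.differentiableAt
    · exact (hderiv x hx).1
  have hFi : Integrable F := by
    refine h.integrable_of_norm_le hdiff.continuous.aestronglyMeasurable (C₁ * (C₂ * ‖e‖)) 1
      fun x hx => ?_
    have := Real.add_one_le_exp ‖x‖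
    rw [hF, Real.norm_eq_abs, abs_mul, abs_mul, Real.abs_exp, abs_of_nonneg (hcut_nonneg x),
      sub_eq_neg_add, Real.exp_add, one_mul]
    calc _ ≤ Real.exp (-ψ x) * 1 * (C₁ * (C₂ * ‖e‖) * ‖x‖) := by
          gcongr
          · exact hcut_le x
          · exact hFb x hx
      _ ≤ Real.exp (-ψ x) * 1 * (C₁ * (C₂ * ‖e‖) * Real.exp ‖x‖) := by
          gcongr
          linarith
      _ = _ := by ring
  have hGi : Integrable G := by
    refine h.integrable_of_norm_le (aestronglyMeasurable_of_continuousOn_compl ?_) (1 / ε * (C₁ * C₃)) 2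
      fun x hx => ?_
    · have : ∀ x, (ψ x + ε) ^ 2 ≠ 0 := fun x => pow_ne_zero 2 (hne x)
      have h1 : Continuous fun x => ε / (ψ x + ε) ^ 2 := by fun_prop (disch := assumption)
      fun_prop
    · have h0 := h.nonneg x
      have e1 : ε / (ψ x + ε) ^ 2 ≤ 1 / ε := by
        rw [div_le_div_iff₀ (by positivity) hε]
        nlinarith
      rw [hG, Real.norm_eq_abs, abs_mul, abs_mul, abs_mul, Real.abs_exp,
        abs_of_nonneg (by positivity : 0 ≤ ε / (ψ x + ε) ^ 2), abs_of_nonneg (sq_nonneg ⟪_, _⟫),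
        sub_eq_neg_add, Real.exp_add]
      calc _ ≤ Real.exp (-ψ x) * (1 / ε) * (C₁ * (C₃ * Real.exp (2 * ‖x‖))) := by
            gcongr
            · exact h₁ x hx
            · exact h₃ x
        _ = _ := by ring
  have hTi : Integrable fun x => Real.exp (-ψ x) * (ψ x / (ψ x + ε)) * divTerm ψ Φ e x := by
    have hd := h.continuousOn_divTerm hΦ e
    refine (h.integrable_exp_neg_mul_divTerm hΦ hhom e).mono
      (aestronglyMeasurable_of_continuousOn_compl (by fun_prop)) (.of_forall fun x => ?_)
    rw [norm_mul, norm_mul, norm_mul, Real.norm_of_nonneg (hcut_nonneg x)]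
    gcongr
    exact mul_le_of_le_one_right (norm_nonneg _) (hcut_le x)
  have hae : ∀ᵐ x : E n, fderiv ℝ F x e =
      Real.exp (-ψ x) * (ψ x / (ψ x + ε)) * divTerm ψ Φ e x + G x := by
    filter_upwards [compl_mem_ae_iff.2 (measure_singleton (0 : E n))] with x hx
    exact (hderiv x hx).2
  have hparts := integral_mul_fderiv_eq_neg_fderiv_mul_of_integrable (μ := (volume : Measure (E n)))
    (f := fun _ => (1 : ℝ)) (g := F) (v := e) (by simp)
    (by simpa using (hTi.add hGi).congr (hae.mono fun x hx => hx.symm)) (by simpa using hFi)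
    (fun x _ => differentiableAt_const _) (fun x _ => hdiff x)
  simp only [one_mul, fderiv_fun_const, Pi.zero_apply, zero_apply, zero_mul,
    integral_zero, neg_zero] at hparts
  rw [integral_congr_ae hae, integral_add hTi hGi] at hparts
  have hG0 : 0 ≤ ∫ x, G x := by
    refine integral_nonneg_of_ae ?_
    filter_upwards [compl_mem_ae_iff.2 (measure_singleton (0 : E n))] with x hx
    have h1 := hΦ0 x hx
    have h2 := h.nonneg x
    simp only [hG, Pi.zero_apply]
    positivity
  linarith

lemma integral_divTerm_nonpos (h : IsQuadGauge ψ) (hΦ : ContDiffOn ℝ 1 Φ {0}ᶜ)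
    (hhom : ∀ (t : ℝ) (x : E n), 0 < t → Φ (t • x) = Φ x) (hΦ0 : ∀ x, x ≠ 0 → 0 ≤ Φ x) (e : E n) :
    ∫ x, Real.exp (-ψ x) * divTerm ψ Φ e x ≤ 0 := by
  have hc := h.continuous
  have hd := h.continuousOn_divTerm hΦ e
  have hpos : ∀ k : ℕ, (0 : ℝ) < 1 / (k + 1) := fun k => by positivity
  refine le_of_tendsto' (f := fun k : ℕ =>
    ∫ x, Real.exp (-ψ x) * (ψ x / (ψ x + 1 / ((k : ℝ) + 1))) * divTerm ψ Φ e x)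
    (tendsto_integral_of_dominated_convergence _ (fun k => ?_)
      (h.integrable_exp_neg_mul_divTerm hΦ hhom e).norm (fun k => .of_forall fun x => ?_) ?_)
    fun k => h.integral_cutoff_mul_divTerm_nonpos hΦ hhom hΦ0 e (hpos k)
  · refine aestronglyMeasurable_of_continuousOn_compl ?_
    have hne : ∀ x, ψ x + 1 / ((k : ℝ) + 1) ≠ 0 := fun x => by
      have := h.nonneg x; have := hpos k; positivity
    have h1 : Continuous fun x => ψ x / (ψ x + 1 / ((k : ℝ) + 1)) := hc.div (by fun_prop) hne
    fun_prop
  · have h0 := h.nonneg x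
    have h1 := hpos k
    have h2 : 0 ≤ ψ x / (ψ x + 1 / ((k : ℝ) + 1)) := by positivity
    rw [norm_mul, norm_mul, norm_mul, Real.norm_of_nonneg h2]
    gcongr
    refine mul_le_of_le_one_right (norm_nonneg _) ?_
    rw [div_le_one (by positivity)]
    linarith
  · filter_upwards [compl_mem_ae_iff.2 (measure_singleton (0 : E n))] with x hx
    have h0 := h.pos hx
    have h1 := (tendsto_one_div_add_atTop_nhds_zero_nat (𝕜 := ℝ)).const_add (ψ x)
    rw [add_zero] at h1
    have h2 := (((tendsto_const_nhds (x := ψ x)).div h1 h0.ne').const_mul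
      (Real.exp (-ψ x))).mul_const (divTerm ψ Φ e x)
    rwa [div_self h0.ne', mul_one] at h2

lemma integral_fderiv_gradient_nonpos (h : IsQuadGauge ψ) (hΦ : ContDiffOn ℝ 1 Φ {0}ᶜ)
    (hhom : ∀ (t : ℝ) (x : E n), 0 < t → Φ (t • x) = Φ x)
    (hdet : ∀ x, x ≠ 0 → Φ x = |(hess ψ x).det|)
    (h0 : ∫ x, weight ψ x • gradient ψ x = 0) :
    ∫ x, Real.exp (-ψ x) * fderiv ℝ Φ x (gradient ψ x) ≤ 0 := by
  have hP := h.continuous_gradient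
  have hc := h.continuous
  have hA := continuousOn_hess h.smooth
  have hD := hΦ.continuousOn_fderiv_of_isOpen isOpen_compl_singleton le_rfl
  obtain ⟨C₂, hC₂, h₂⟩ := h.exists_bound_hess
  have hinteg : ∀ e : E n,
      Integrable fun x => Real.exp (-ψ x) * (fderiv ℝ Φ x e * ⟪gradient ψ x, e⟫) := by
    intro e
    obtain ⟨C, hC, hCb⟩ := h.exists_bound_fderiv_mul hΦ hhom e
    refine h.integrable_of_norm_le (aestronglyMeasurable_of_continuousOn_compl (by fun_prop)) C 0
      fun x hx => ?_
    rw [norm_mul, Real.norm_eq_abs, Real.abs_exp, zero_mul, zero_sub, mul_comm]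
    gcongr
    exact hCb x hx
  have hsum : ∀ x, Real.exp (-ψ x) * fderiv ℝ Φ x (gradient ψ x) = ∑ i : Fin (n + 1),
      Real.exp (-ψ x) * (fderiv ℝ Φ x (EuclideanSpace.basisFun (Fin (n + 1)) ℝ i) *
        ⟪gradient ψ x, EuclideanSpace.basisFun (Fin (n + 1)) ℝ i⟫) := by
    intro x
    rw [← Finset.mul_sum]
    congr 1
    conv_lhs => rw [← (EuclideanSpace.basisFun (Fin (n + 1)) ℝ).sum_repr' (gradient ψ x)]
    rw [map_sum]
    refine Finset.sum_congr rfl fun i _ => ?_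
    rw [map_smul, smul_eq_mul, mul_comm, real_inner_comm]
  simp_rw [hsum]
  rw [integral_finsetSum _ fun i _ => hinteg _]
  refine Finset.sum_nonpos fun i _ => ?_
  set e : E n := EuclideanSpace.basisFun (Fin (n + 1)) ℝ i
  obtain ⟨C₃, hC₃, h₃⟩ := h.inner_gradient_sq_le e
  obtain ⟨C₁, hC₁, h₁⟩ := h.exists_bound_gradient
  have hPi : Integrable fun x => weight ψ x • gradient ψ x :=
    h.integrable_weight_smul hP.aestronglyMeasurable C₁ 1 fun x _ => (h₁ x).trans (by
      gcongr
      rw [one_mul]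
      linarith [Real.add_one_le_exp ‖x‖])
  have h0e : ∫ x, weight ψ x • ⟪gradient ψ x, e⟫ = 0 := by
    have := integral_inner (𝕜 := ℝ) hPi e
    rw [h0, inner_zero_right] at this
    rw [← this]
    refine integral_congr_ae (.of_forall fun x => ?_)
    beta_reduce
    rw [smul_eq_mul, real_inner_smul_right, real_inner_comm]
  have hBL := h.integral_inner_gradient_sq_le e h0e
  have hi1 : Integrable fun x => weight ψ x • ⟪gradient ψ x, e⟫ ^ 2 :=
    h.integrable_weight_smul (Continuous.aestronglyMeasurable (by fun_prop)) C₃ 2 fun x _ => by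
      rw [Real.norm_of_nonneg (sq_nonneg _)]; exact h₃ x
  have hi2 : Integrable fun x => weight ψ x • ⟪hess ψ x e, e⟫ :=
    h.integrable_weight_smul (aestronglyMeasurable_of_continuousOn_compl (by fun_prop))
      (C₂ * ‖e‖ * ‖e‖) 0 fun x hx => by
        rw [zero_mul, Real.exp_zero, mul_one]
        refine (norm_inner_le_norm _ _).trans ?_
        gcongr
        exact (hess ψ x).le_of_opNorm_le (h₂ x hx) e
  have hdiv := h.integral_divTerm_nonpos hΦ hhom (fun x hx => by rw [hdet x hx]; positivity) e
  have hae : ∀ᵐ x : E n, Real.exp (-ψ x) * divTerm ψ Φ e x =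
      (weight ψ x • ⟪hess ψ x e, e⟫ - weight ψ x • ⟪gradient ψ x, e⟫ ^ 2) +
        Real.exp (-ψ x) * (fderiv ℝ Φ x e * ⟪gradient ψ x, e⟫) := by
    filter_upwards [compl_mem_ae_iff.2 (measure_singleton (0 : E n))] with x hx
    rw [divTerm, hdet x hx, weight, smul_eq_mul, smul_eq_mul]
    ring
  rw [integral_congr_ae hae, integral_add (by exact hi2.sub hi1) (hinteg e),
    integral_sub hi2 hi1] at hdiv
  linarith

lemma fderiv_gradient_eq_zero (h : IsQuadGauge ψ) (hΦ : ContDiffOn ℝ 1 Φ {0}ᶜ)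
    (hhom : ∀ (t : ℝ) (x : E n), 0 < t → Φ (t • x) = Φ x)
    (hdet : ∀ x, x ≠ 0 → Φ x = |(hess ψ x).det|)
    (h0 : ∫ x, weight ψ x • gradient ψ x = 0)
    (hR : ∀ x, x ≠ 0 → 0 ≤ fderiv ℝ Φ x (gradient ψ x)) {x : E n} (hx : x ≠ 0) :
    fderiv ℝ Φ x (gradient ψ x) = 0 := by
  have hP := h.continuous_gradient
  have hc := h.continuous
  have hD := hΦ.continuousOn_fderiv_of_isOpen isOpen_compl_singleton le_rfl
  have hcont : ContinuousOn (fun x => fderiv ℝ Φ x (gradient ψ x)) {0}ᶜ := by fun_prop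
  obtain ⟨C, hC, hCb⟩ := exists_bound_of_homogeneous hcont fun t x ht hx => by
    rw [fderiv_smul_of_homogeneous hhom ht, h.gradient_smul ht, smul_apply,
      map_smul, smul_smul, inv_mul_cancel₀ ht.ne', one_smul]
  have hcont' : ContinuousOn (fun x => Real.exp (-ψ x) * fderiv ℝ Φ x (gradient ψ x)) {0}ᶜ := by
    fun_prop
  have hi : Integrable fun x => Real.exp (-ψ x) * fderiv ℝ Φ x (gradient ψ x) := by
    refine h.integrable_of_norm_le (aestronglyMeasurable_of_continuousOn_compl hcont') C 0
      fun x hx => ?_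
    rw [norm_mul, Real.norm_eq_abs, Real.abs_exp, zero_mul, zero_sub, mul_comm]
    gcongr
    exact hCb x hx
  have hnn : 0 ≤ᵐ[volume] fun x => Real.exp (-ψ x) * fderiv ℝ Φ x (gradient ψ x) := by
    filter_upwards [compl_mem_ae_iff.2 (measure_singleton (0 : E n))] with x hx
    exact mul_nonneg (Real.exp_pos _).le (hR x hx)
  have h1 := (integral_eq_zero_iff_of_nonneg_ae hnn hi).1
    (le_antisymm (h.integral_fderiv_gradient_nonpos hΦ hhom hdet h0) (integral_nonneg_of_ae hnn))
  have h2 := Measure.eqOn_open_of_ae_eq (U := {(0 : E n)}ᶜ) (ae_restrict_of_ae h1)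
    isOpen_compl_singleton hcont' continuousOn_const
  have h3 := h2 hx
  simpa [(Real.exp_pos _).ne'] using h3

end IsQuadGauge

lemma hasFDerivAt_norm_comp {V F : Type*} [NormedAddCommGroup V] [NormedSpace ℝ V]
    [NormedAddCommGroup F] [InnerProductSpace ℝ F] {f : V → F} {f' : V →L[ℝ] F} {x : V}
    (hf : HasFDerivAt f f' x) (hx : f x ≠ 0) :
    HasFDerivAt (fun y => ‖f y‖) (‖f x‖⁻¹ • (innerSL ℝ (f x)).comp f') x := by
  have hx' : ‖f x‖ ≠ 0 := norm_ne_zero_iff.2 hx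
  have h1 := hf.norm_sq.sqrt (pow_ne_zero 2 hx')
  simp_rw [Real.sqrt_sq (norm_nonneg _)] at h1
  refine h1.congr_fderiv ?_
  ext v
  simp
  field_simp

/-- A smooth support function of a strictly convex body containing the origin in its interior,
extended positively `1`-homogeneously. -/
structure IsSmoothSupport {n : ℕ} (H : E n → ℝ) : Prop where
  hom : ∀ (t : ℝ) (x : E n), 0 < t → H (t • x) = t * H x
  smooth : ContDiffOn ℝ (⊤ : ℕ∞) H {(0 : E n)}ᶜ
  pos_sphere : ∀ x ∈ sphere (0 : E n) 1, 0 < H x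
  convex : ∀ x ∈ sphere (0 : E n) 1, ∀ v : E n, ⟪v, x⟫ = 0 → v ≠ 0 → 0 < ⟪(hess H x) v, v⟫

namespace IsSmoothSupport

variable {n : ℕ} {H : E n → ℝ}

lemma pos (h : IsSmoothSupport H) {x : E n} (hx : x ≠ 0) : 0 < H x := by
  have hx' : 0 < ‖x‖ := norm_pos_iff.2 hx
  have h1 := h.pos_sphere (‖x‖⁻¹ • x) (by simp [norm_smul, hx'.ne'])
  rw [h.hom _ _ (inv_pos.2 hx')] at h1
  exact pos_of_mul_pos_right h1 (inv_pos.2 hx').le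

lemma gradient_smul (h : IsSmoothSupport H) {t : ℝ} (ht : 0 < t) (x : E n) :
    gradient H (t • x) = gradient H x := by
  have e : (fun y => H (t • y)) = fun y => t • H y := funext fun y => h.hom t y ht
  have h1 : fderiv ℝ (fun y => H (t • y)) x = t • fderiv ℝ H (t • x) := fderiv_comp_smul t
  have h2 : fderiv ℝ (fun y => t • H y) x = t • fderiv ℝ H x := by
    exact congrFun (fderiv_const_smul_field (𝕜 := ℝ) (R := ℝ) (f := H) t) x
  rw [e, h2] at h1
  rw [gradient, gradient, smul_right_injective _ ht.ne' h1]

lemma hess_smul (h : IsSmoothSupport H) {t : ℝ} (ht : 0 < t) (x : E n) :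
    hess H (t • x) = t⁻¹ • hess H x := by
  have e : (fun y => gradient H (t • y)) = gradient H := funext fun y => h.gradient_smul ht y
  have h1 : fderiv ℝ (fun y => gradient H (t • y)) x = t • fderiv ℝ (gradient H) (t • x) :=
    fderiv_comp_smul t
  rw [e] at h1
  rw [hess, hess, h1, smul_smul, inv_mul_cancel₀ ht.ne', one_smul]

lemma inner_gradient_self (h : IsSmoothSupport H) {x : E n} (hx : x ≠ 0) :
    ⟪gradient H x, x⟫ = H x := by
  have hc : HasDerivAt (fun t : ℝ => t • x) x 1 := by
    simpa using (hasDerivAt_id (1 : ℝ)).smul_const x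
  have h1 : HasDerivAt (fun t : ℝ => H (t • x)) ⟪gradient H x, x⟫ 1 := by
    have := (hasGradientAt_of_contDiffOn h.smooth
      (x := (1 : ℝ) • x) (by simpa)).hasFDerivAt.comp_hasDerivAt 1 hc
    simpa [Function.comp_def] using this
  have h2 : HasDerivAt (fun t : ℝ => H (t • x)) (H x) 1 := by
    have : HasDerivAt (fun t : ℝ => t * H x) (H x) 1 := by
      simpa using (hasDerivAt_id (1 : ℝ)).mul_const (H x)
    refine this.congr_of_eventuallyEq ?_
    filter_upwards [lt_mem_nhds (zero_lt_one' ℝ)] with t ht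
    exact h.hom t x ht
  exact h1.unique h2

lemma hess_self (h : IsSmoothSupport H) {x : E n} (hx : x ≠ 0) : hess H x x = 0 := by
  have hc : HasDerivAt (fun t : ℝ => t • x) x 1 := by
    simpa using (hasDerivAt_id (1 : ℝ)).smul_const x
  have h1 : HasDerivAt (fun t : ℝ => gradient H (t • x)) (hess H x x) 1 := by
    have := (hasFDerivAt_gradient h.smooth (x := (1 : ℝ) • x) (by simpa)).comp_hasDerivAt 1 hc
    simpa [Function.comp_def] using this
  have h2 : HasDerivAt (fun t : ℝ => gradient H (t • x)) 0 1 := by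
    refine (hasDerivAt_const (1 : ℝ) (gradient H x)).congr_of_eventuallyEq ?_
    filter_upwards [lt_mem_nhds (zero_lt_one' ℝ)] with t ht
    exact h.gradient_smul ht x
  exact h1.unique h2

lemma gradient_ne_zero (h : IsSmoothSupport H) {x : E n} (hx : x ≠ 0) : gradient H x ≠ 0 := by
  intro h0
  have h1 := h.inner_gradient_self hx
  have h2 := h.pos hx
  rw [h0, inner_zero_left] at h1
  linarith

lemma hess_pos_of_orthogonal (h : IsSmoothSupport H) {x v : E n} (hx : x ≠ 0) (hv : v ≠ 0)
    (hvx : ⟪v, x⟫ = 0) : 0 < ⟪hess H x v, v⟫ := by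
  have hx' : 0 < ‖x‖ := norm_pos_iff.2 hx
  have h1 := h.convex (‖x‖⁻¹ • x) (by simp [norm_smul, hx'.ne']) v
    (by rw [real_inner_smul_right, hvx, mul_zero]) hv
  rw [h.hess_smul (inv_pos.2 hx'), inv_inv, smul_apply, real_inner_smul_left] at h1
  exact pos_of_mul_pos_right h1 hx'.le

lemma hess_add_smul_self (h : IsSmoothSupport H) {x : E n} (hx : x ≠ 0) (w : E n) (c : ℝ) :
    ⟪hess H x (w + c • x), w + c • x⟫ = ⟪hess H x w, w⟫ := by
  have h0 := h.hess_self hx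
  have h1 := inner_hess_comm h.smooth hx w x
  rw [h0, inner_zero_right] at h1
  rw [map_add, map_smul, h0, smul_zero, add_zero, inner_add_right, real_inner_smul_right, h1,
    mul_zero, add_zero]

lemma exists_orthogonal_decomposition {x : E n} (hx : x ≠ 0) (v : E n) :
    ∃ (w : E n) (c : ℝ), ⟪w, x⟫ = 0 ∧ v = w + c • x := by
  have hx' : ‖x‖ ≠ 0 := norm_ne_zero_iff.2 hx
  refine ⟨v - (⟪v, x⟫ / ‖x‖ ^ 2) • x, ⟪v, x⟫ / ‖x‖ ^ 2, ?_, by abel⟩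
  rw [inner_sub_left, real_inner_smul_left, real_inner_self_eq_norm_sq,
    div_mul_cancel₀ _ (pow_ne_zero 2 hx'), sub_self]

lemma hess_nonneg (h : IsSmoothSupport H) {x : E n} (hx : x ≠ 0) (v : E n) :
    0 ≤ ⟪hess H x v, v⟫ := by
  obtain ⟨w, c, hw, rfl⟩ := exists_orthogonal_decomposition hx v
  rw [h.hess_add_smul_self hx]
  by_cases hw0 : w = 0
  · simp [hw0]
  · exact (h.hess_pos_of_orthogonal hx hw0 hw).le

lemma exists_eq_smul_of_hess_eq_zero (h : IsSmoothSupport H) {x : E n} (hx : x ≠ 0) {v : E n}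
    (hv : ⟪hess H x v, v⟫ = 0) : ∃ c : ℝ, v = c • x := by
  obtain ⟨w, c, hw, rfl⟩ := exists_orthogonal_decomposition hx v
  rw [h.hess_add_smul_self hx] at hv
  by_cases hw0 : w = 0
  · exact ⟨c, by simp [hw0]⟩
  · exact absurd hv (h.hess_pos_of_orthogonal hx hw0 hw).ne'

lemma gradient_half_sq (h : IsSmoothSupport H) {x : E n} (hx : x ≠ 0) :
    gradient (fun x => H x ^ 2 / 2) x = H x • gradient H x := by
  have h1 := (hasGradientAt_of_contDiffOn h.smooth hx).hasFDerivAt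
  have h2 : HasFDerivAt (fun x => H x ^ 2 / 2)
      (InnerProductSpace.toDual ℝ (E n) (H x • gradient H x)) x := by
    have h3 := (((hasDerivAt_pow 2 (H x)).div_const 2).comp_hasFDerivAt x h1)
    refine h3.congr_fderiv ?_
    ext v
    simp
  exact HasGradientAt.gradient h2

lemma hess_half_sq (h : IsSmoothSupport H) {x : E n} (hx : x ≠ 0) (v : E n) :
    hess (fun x => H x ^ 2 / 2) x v = H x • hess H x v + ⟪gradient H x, v⟫ • gradient H x := by
  have h1 := (hasGradientAt_of_contDiffOn h.smooth hx).hasFDerivAt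
  have h2 := hasFDerivAt_gradient h.smooth hx
  have h3 := h1.smul h2
  have he : (gradient fun x => H x ^ 2 / 2) =ᶠ[nhds x] fun y => H y • gradient H y := by
    filter_upwards [isOpen_compl_singleton.mem_nhds hx] with y hy
    exact h.gradient_half_sq hy
  rw [hess, (h3.congr_of_eventuallyEq he).fderiv]
  rfl

lemma isQuadGauge (h : IsSmoothSupport H) : IsQuadGauge fun x => H x ^ 2 / 2 where
  hom t x ht := by rw [h.hom t x ht]; ring
  smooth := (h.smooth.pow 2).div_const 2
  posDef x hx v hv := by
    rw [h.hess_half_sq hx, inner_add_left, real_inner_smul_left, real_inner_smul_left]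
    have h1 := h.hess_nonneg hx v
    have h2 := h.pos hx
    rcases h1.eq_or_lt with h0 | h0
    · obtain ⟨c, rfl⟩ := h.exists_eq_smul_of_hess_eq_zero hx h0.symm
      have hc : c ≠ 0 := by rintro rfl; simp at hv
      rw [← h0, real_inner_smul_right, h.inner_gradient_self hx]
      have : 0 < (c * H x) ^ 2 := by positivity
      nlinarith
    · nlinarith [mul_pos h2 h0, mul_self_nonneg ⟪gradient H x, v⟫]

lemma det_hess_half_sq (h : IsSmoothSupport H) {x : E n} (hx : ‖x‖ = 1) :
    (hess (fun x => H x ^ 2 / 2) x).det = H x ^ (n + 2) * sigmaDet H x := by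
  have hx0 : x ≠ 0 := norm_ne_zero_iff.1 (by rw [hx]; norm_num)
  have hH := h.pos hx0
  have hxx : ⟪x, x⟫ = 1 := by rw [real_inner_self_eq_norm_sq, hx, one_pow]
  have hpx := h.inner_gradient_self hx0
  set q : E n := gradient H x - H x • x with hq
  have hqx : ⟪q, x⟫ = 0 := by
    rw [hq, inner_sub_left, real_inner_smul_left, hxx, hpx, mul_one, sub_self]
  set f : Module.Dual ℝ (E n) := (innerSL ℝ x).toLinearMap with hf
  set g : Module.Dual ℝ (E n) := (innerSL ℝ q).toLinearMap with hg
  have hfa : ∀ y, f y = ⟪x, y⟫ := fun y => rfl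
  have hga : ∀ y, g y = ⟪q, y⟫ := fun y => rfl
  have hMx : ∀ y, ⟪x, hess H x y⟫ = 0 := fun y => by
    rw [← inner_hess_comm h.smooth hx0, h.hess_self hx0, inner_zero_left]
  have hfac : (hess (fun x => H x ^ 2 / 2) x).toLinearMap =
      LinearMap.transvection ((H x)⁻¹ • f) q ∘ₗ ((hess H x + proj x : E n →L[ℝ] E n).toLinearMap ∘ₗ
        (H x • LinearMap.transvection ((H x - 1) • f) x)) ∘ₗ
          LinearMap.transvection ((H x)⁻¹ • g) x := by
    ext1 y
    have hgy : ⟪gradient H x, y⟫ = ⟪q, y⟫ + H x * ⟪x, y⟫ := by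
      rw [hq, inner_sub_left, real_inner_smul_left]; ring
    have hgrad : gradient H x = q + H x • x := by rw [hq]; abel
    have hy : hess (fun x => H x ^ 2 / 2) x y =
        H x • hess H x y + (⟪q, y⟫ + H x * ⟪x, y⟫) • (q + H x • x) := by
      rw [h.hess_half_sq hx0, hgy, ← hgrad]
    rw [ContinuousLinearMap.coe_coe, hy]
    simp only [LinearMap.comp_apply, LinearMap.smul_apply, LinearMap.transvection.apply, hfa, hga,
      ContinuousLinearMap.coe_coe, add_apply, proj, map_add, map_smul,
      h.hess_self hx0, ContinuousLinearMap.smulRight_apply, innerSL_apply_apply, smul_eq_mul,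
      inner_zero_right, hxx, hMx]
    match_scalars <;> field_simp <;> ring
  rw [ContinuousLinearMap.det, hfac, LinearMap.det_comp, LinearMap.det_comp, LinearMap.det_comp,
    LinearMap.det_smul, LinearMap.transvection.det, LinearMap.transvection.det,
    LinearMap.transvection.det, finrank_euclideanSpace_fin, sigmaDet]
  have hxq : ⟪x, q⟫ = 0 := by rw [real_inner_comm, hqx]
  simp only [LinearMap.smul_apply, hfa, hga, hqx, hxq, hxx, smul_eq_mul]
  ring

end IsSmoothSupport

lemma deriv_fst_eq_fderiv_uncurry {φ : ℝ → ℝ → ℝ} {a b : ℝ}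
    (h : DifferentiableAt ℝ (Function.uncurry φ) (a, b)) :
    deriv (fun t => φ t b) a = fderiv ℝ (Function.uncurry φ) (a, b) (1, 0) :=
  (HasFDerivAt.comp_hasDerivAt (f := fun t : ℝ => (t, b)) a h.hasFDerivAt
    ((hasDerivAt_id a).prodMk (hasDerivAt_const a b))).deriv

lemma deriv_snd_eq_fderiv_uncurry {φ : ℝ → ℝ → ℝ} {a b : ℝ}
    (h : DifferentiableAt ℝ (Function.uncurry φ) (a, b)) :
    deriv (fun t => φ a t) b = fderiv ℝ (Function.uncurry φ) (a, b) (0, 1) :=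
  (HasFDerivAt.comp_hasDerivAt (f := fun t : ℝ => (a, t)) b h.hasFDerivAt
    ((hasDerivAt_const b a).prodMk (hasDerivAt_id b))).deriv

namespace IsSmoothSupport

variable {n : ℕ} {H : E n → ℝ}

lemma hasFDerivAt_div_norm (h : IsSmoothSupport H) {x : E n} (hx : x ≠ 0) :
    HasFDerivAt (fun y => H y / ‖y‖)
      (innerSL ℝ (‖x‖⁻¹ • (gradient H x - (H x / ‖x‖ ^ 2) • x))) x := by
  have hx' : ‖x‖ ≠ 0 := norm_ne_zero_iff.2 hx
  have h1 := (hasGradientAt_of_contDiffOn h.smooth hx).hasFDerivAt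
  have h2 := (hasDerivAt_inv hx').comp_hasFDerivAt x (hasFDerivAt_norm_comp (hasFDerivAt_id x) hx)
  simp only [div_eq_mul_inv]
  refine (h1.mul h2).congr_fderiv ?_
  ext v
  simp only [Function.comp_apply, add_apply, smul_apply, InnerProductSpace.toDual_apply_apply,
    ContinuousLinearMap.comp_apply, innerSL_apply_apply, ContinuousLinearMap.id_apply,
    smul_eq_mul, real_inner_smul_left, inner_sub_left]
  field_simp
  ring

lemma inner_gradient_sub_gradient (h : IsSmoothSupport H) {x : E n} (hx : x ≠ 0) :
    ⟪gradient H x - (H x / ‖x‖ ^ 2) • x, gradient H x⟫ =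
      ‖gradient H x - (H x / ‖x‖ ^ 2) • x‖ ^ 2 := by
  have hx' : ‖x‖ ≠ 0 := norm_ne_zero_iff.2 hx
  have h1 : ⟪gradient H x - (H x / ‖x‖ ^ 2) • x, x⟫ = 0 := by
    rw [inner_sub_left, real_inner_smul_left, real_inner_self_eq_norm_sq, h.inner_gradient_self hx]
    field_simp
    ring
  nth_rewrite 2 [← sub_add_cancel (gradient H x) ((H x / ‖x‖ ^ 2) • x)]
  rw [inner_add_right, real_inner_smul_right, h1, mul_zero, add_zero, real_inner_self_eq_norm_sq]

lemma fderiv_comp_gradient_apply (h : IsSmoothSupport H) {F : ℝ × ℝ → ℝ} {x : E n} (hx : x ≠ 0)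
    (hF : DifferentiableAt ℝ F (H x / ‖x‖, ‖gradient H x‖)) :
    fderiv ℝ (fun y => F (H y / ‖y‖, ‖gradient H y‖)) x (H x • gradient H x) =
      H x * (fderiv ℝ F (H x / ‖x‖, ‖gradient H x‖) (1, 0) *
          (‖x‖⁻¹ * ‖gradient H x - (H x / ‖x‖ ^ 2) • x‖ ^ 2) +
        fderiv ℝ F (H x / ‖x‖, ‖gradient H x‖) (0, 1) *
          (‖gradient H x‖⁻¹ * ⟪hess H x (gradient H x), gradient H x⟫)) := by
  have h1 := h.hasFDerivAt_div_norm hx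
  have h2 := hasFDerivAt_norm_comp (hasFDerivAt_gradient h.smooth hx) (h.gradient_ne_zero hx)
  have h3 := hF.hasFDerivAt.comp x (h1.prodMk h2)
  have h4 := h3.fderiv
  simp only [Function.comp_def] at h4
  rw [h4]
  have hL : ∀ s t : ℝ, fderiv ℝ F (H x / ‖x‖, ‖gradient H x‖) (s, t) =
      s * fderiv ℝ F (H x / ‖x‖, ‖gradient H x‖) (1, 0) +
        t * fderiv ℝ F (H x / ‖x‖, ‖gradient H x‖) (0, 1) := fun s t => by
    have : ((s, t) : ℝ × ℝ) = s • (1, 0) + t • (0, 1) := by simp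
    rw [this, map_add, map_smul, map_smul, smul_eq_mul, smul_eq_mul]
  rw [ContinuousLinearMap.comp_apply, ContinuousLinearMap.prod_apply, hL]
  simp only [smul_apply, ContinuousLinearMap.comp_apply, innerSL_apply_apply, map_smul,
    h.inner_gradient_sub_gradient hx, smul_eq_mul]
  rw [real_inner_comm (hess H x (gradient H x))]
  ring

lemma body_eq_closedBall (h : IsSmoothSupport H) (hn : 1 ≤ n)
    (hx : ∀ x : E n, x ≠ 0 → gradient H x = (H x / ‖x‖ ^ 2) • x) :
    ∃ r : ℝ, 0 < r ∧ body H = closedBall (0 : E n) r := by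
  have hrank : 1 < Module.rank ℝ (E n) := by
    rw [← Module.finrank_eq_rank, finrank_euclideanSpace_fin]
    exact_mod_cast Nat.lt_succ_of_le hn
  have hd : ∀ x : E n, x ≠ 0 → HasFDerivAt (fun y => H y / ‖y‖) (0 : E n →L[ℝ] ℝ) x := by
    intro x hx0
    have := h.hasFDerivAt_div_norm hx0
    rwa [hx x hx0, sub_self, smul_zero, map_zero] at this
  obtain ⟨r, hr⟩ := isOpen_compl_singleton.exists_is_const_of_fderiv_eq_zero
    (isConnected_compl_singleton_of_one_lt_rank hrank (0 : E n)).isPreconnected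
    (fun x hx0 => (hd x hx0).differentiableAt.differentiableWithinAt)
    (fun x hx0 => (hd x hx0).fderiv)
  have hs : ∀ x ∈ sphere (0 : E n) 1, H x = r := fun x hx1 => by
    have h1 : ‖x‖ = 1 := by simpa using hx1
    have h0 : x ≠ 0 := norm_ne_zero_iff.1 (by rw [h1]; exact one_ne_zero)
    simpa [h1] using hr x h0
  obtain ⟨e, he⟩ : (sphere (0 : E n) 1).Nonempty := NormedSpace.sphere_nonempty.2 zero_le_one
  have hr0 : 0 < r := hs e he ▸ h.pos_sphere e he
  refine ⟨r, hr0, ?_⟩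
  ext y
  rw [mem_closedBall_zero_iff]
  constructor
  · intro hy
    by_cases hy0 : y = 0
    · simpa [hy0] using hr0.le
    have hy' : ‖y‖ ≠ 0 := norm_ne_zero_iff.2 hy0
    have hm : ‖y‖⁻¹ • y ∈ sphere (0 : E n) 1 := by simp [norm_smul, hy']
    have h1 := hy _ hm
    rw [hs _ hm, real_inner_smul_right, real_inner_self_eq_norm_sq, pow_two, ← mul_assoc,
      inv_mul_cancel₀ hy', one_mul] at h1
    exact h1
  · intro hy x hx1
    rw [hs x hx1]
    have h1 : ‖x‖ = 1 := by simpa using hx1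
    calc ⟪y, x⟫ ≤ ‖y‖ * ‖x‖ := real_inner_le_norm y x
      _ ≤ r := by rwa [h1, mul_one]

end IsSmoothSupport

/-- Uniqueness for the generalized isotropic problem `φ(h, |Dh|) 𝒦 = h^{n+2}` for
origin-centred bodies: `φ` is C¹ on `(0,∞)²` with nonnegative partial derivatives,
at least one of them strictly positive everywhere; then the body is an
origin-centred ball. -/
theorem stmt19 (n : ℕ) (hn : 2 ≤ n) (φ : ℝ → ℝ → ℝ)
    (hφC1 : ContDiffOn ℝ 1 (Function.uncurry φ) (Set.Ioi (0 : ℝ) ×ˢ Set.Ioi (0 : ℝ)))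
    (hφpos : ∀ a b : ℝ, 0 < a → 0 < b → 0 < φ a b)
    (hφ₁ : ∀ a b : ℝ, 0 < a → 0 < b → 0 ≤ deriv (fun t => φ t b) a)
    (hφ₂ : ∀ a b : ℝ, 0 < a → 0 < b → 0 ≤ deriv (fun t => φ a t) b)
    (hstrict : (∀ a b : ℝ, 0 < a → 0 < b → 0 < deriv (fun t => φ t b) a) ∨
               (∀ a b : ℝ, 0 < a → 0 < b → 0 < deriv (fun t => φ a t) b))
    (H : E n → ℝ)
    (hhom : ∀ (t : ℝ) (x : E n), 0 < t → H (t • x) = t * H x)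
    (hsmooth : ContDiffOn ℝ (⊤ : ℕ∞) H {(0 : E n)}ᶜ)
    (hpos : ∀ x ∈ sphere (0 : E n) 1, 0 < H x)
    (hconvex : ∀ x ∈ sphere (0 : E n) 1, ∀ v : E n, ⟪v, x⟫ = 0 → v ≠ 0 →
      0 < ⟪(hess H x) v, v⟫)
    (hcentroid : ∫ y in body H, y = 0)
    (hflow : ∀ x ∈ sphere (0 : E n) 1,
      φ (H x) ‖gradient H x‖ * (sigmaDet H x)⁻¹ = (H x) ^ (n + 2)) :
    ∃ r : ℝ, 0 < r ∧ body H = Metric.closedBall (0 : E n) r := by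
  have h : IsSmoothSupport H := ⟨hhom, hsmooth, hpos, hconvex⟩
  have hq := h.isQuadGauge
  have ha : ∀ x : E n, x ≠ 0 → 0 < H x / ‖x‖ := fun x hx => div_pos (h.pos hx) (norm_pos_iff.2 hx)
  have hb : ∀ x : E n, x ≠ 0 → 0 < ‖gradient H x‖ := fun x hx =>
    norm_pos_iff.2 (h.gradient_ne_zero hx)
  have hφd : ∀ x : E n, x ≠ 0 →
      DifferentiableAt ℝ (Function.uncurry φ) (H x / ‖x‖, ‖gradient H x‖) := fun x hx =>
    (hφC1.contDiffAt ((isOpen_Ioi.prod isOpen_Ioi).mem_nhds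
      (Set.mk_mem_prod (ha x hx) (hb x hx)))).differentiableAt one_ne_zero
  set Φ : E n → ℝ := fun x => Function.uncurry φ (H x / ‖x‖, ‖gradient H x‖) with hΦ
  have hΦC : ContDiffOn ℝ 1 Φ {0}ᶜ := by
    refine hφC1.comp (ContDiffOn.prodMk ?_ ?_) fun x hx => ⟨ha x hx, hb x hx⟩
    · exact (h.smooth.of_le (by simp)).div (contDiffOn_id.norm ℝ fun x hx => hx)
        fun x hx => norm_ne_zero_iff.2 hx
    · exact ((contDiffOn_gradient h.smooth).of_le (by simp)).norm ℝ fun x hx => h.gradient_ne_zero hx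
  have hΦh : ∀ (t : ℝ) (x : E n), 0 < t → Φ (t • x) = Φ x := by
    intro t x ht
    simp only [hΦ]
    rw [h.hom t x ht, h.gradient_smul ht, norm_smul, Real.norm_of_nonneg ht.le,
      mul_div_mul_left _ _ ht.ne']
  have hΦd : ∀ x, x ≠ 0 → Φ x = |(hess (fun x => H x ^ 2 / 2) x).det| := by
    intro x hx
    have hx' : 0 < ‖x‖ := norm_pos_iff.2 hx
    have hu : ‖‖x‖⁻¹ • x‖ = 1 := by simp [norm_smul, hx'.ne']
    rw [← hΦh _ x (inv_pos.2 hx'), ← hq.hess_smul (inv_pos.2 hx')]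
    set u := ‖x‖⁻¹ • x with hu_def
    have hu0 : u ≠ 0 := norm_ne_zero_iff.1 (by rw [hu]; exact one_ne_zero)
    have h1 := hflow u (by simpa using hu)
    have hHu := h.pos hu0
    have h2 : 0 < φ (H u) ‖gradient H u‖ := hφpos _ _ hHu (hb u hu0)
    have h3 : sigmaDet H u ≠ 0 := by
      intro h0
      rw [h0, inv_zero, mul_zero] at h1
      exact (pow_pos hHu _).ne h1
    have h4 : φ (H u) ‖gradient H u‖ = H u ^ (n + 2) * sigmaDet H u := by
      rw [← h1, inv_mul_cancel_right₀ h3]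
    rw [h.det_hess_half_sq hu, ← h4, abs_of_pos h2]
    simp only [hΦ, Function.uncurry_apply_pair, hu, div_one]
  have hΦD : ∀ x, x ≠ 0 → fderiv ℝ Φ x (gradient (fun x => H x ^ 2 / 2) x) =
      H x * (deriv (fun t => φ t ‖gradient H x‖) (H x / ‖x‖) *
          (‖x‖⁻¹ * ‖gradient H x - (H x / ‖x‖ ^ 2) • x‖ ^ 2) +
        deriv (fun t => φ (H x / ‖x‖) t) ‖gradient H x‖ *
          (‖gradient H x‖⁻¹ * ⟪hess H x (gradient H x), gradient H x⟫)) := fun x hx => by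
    rw [h.gradient_half_sq hx, deriv_fst_eq_fderiv_uncurry (hφd x hx),
      deriv_snd_eq_fderiv_uncurry (hφd x hx)]
    exact h.fderiv_comp_gradient_apply hx (hφd x hx)
  have hT₁ : ∀ x, x ≠ 0 → 0 ≤ deriv (fun t => φ t ‖gradient H x‖) (H x / ‖x‖) *
      (‖x‖⁻¹ * ‖gradient H x - (H x / ‖x‖ ^ 2) • x‖ ^ 2) := fun x hx =>
    mul_nonneg (hφ₁ _ _ (ha x hx) (hb x hx)) (by positivity)
  have hT₂ : ∀ x, x ≠ 0 → 0 ≤ deriv (fun t => φ (H x / ‖x‖) t) ‖gradient H x‖ *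
      (‖gradient H x‖⁻¹ * ⟪hess H x (gradient H x), gradient H x⟫) := fun x hx =>
    mul_nonneg (hφ₂ _ _ (ha x hx) (hb x hx))
      (mul_nonneg (inv_nonneg.2 (norm_nonneg _)) (h.hess_nonneg hx _))
  have hR : ∀ x, x ≠ 0 → 0 ≤ fderiv ℝ Φ x (gradient (fun x => H x ^ 2 / 2) x) := fun x hx => by
    rw [hΦD x hx]
    exact mul_nonneg (h.pos hx).le (add_nonneg (hT₁ x hx) (hT₂ x hx))
  refine h.body_eq_closedBall (by omega) fun x hx => ?_
  have h0 := hq.fderiv_gradient_eq_zero hΦC hΦh hΦd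
    (integral_weight_smul_gradient_eq_zero hq hhom hpos hcentroid) hR hx
  rw [hΦD x hx, mul_eq_zero, or_iff_right (h.pos hx).ne',
    add_eq_zero_iff_of_nonneg (hT₁ x hx) (hT₂ x hx)] at h0
  rcases hstrict with hs | hs
  · have h1 := h0.1
    rw [mul_eq_zero, or_iff_right (hs _ _ (ha x hx) (hb x hx)).ne', mul_eq_zero,
      or_iff_right (inv_ne_zero (norm_ne_zero_iff.2 hx)), pow_eq_zero_iff two_ne_zero,
      norm_eq_zero, sub_eq_zero] at h1
    exact h1
  · have h1 := h0.2
    rw [mul_eq_zero, or_iff_right (hs _ _ (ha x hx) (hb x hx)).ne', mul_eq_zero,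
      or_iff_right (inv_ne_zero (hb x hx).ne')] at h1
    obtain ⟨c, hc⟩ := h.exists_eq_smul_of_hess_eq_zero hx h1
    have h2 := h.inner_gradient_self hx
    rw [hc, real_inner_smul_left, real_inner_self_eq_norm_sq] at h2
    rw [hc, ← h2, mul_div_cancel_right₀ _ (pow_ne_zero 2 (norm_ne_zero_iff.2 hx))]

end
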